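/- arXiv:1503.01212 — 10 statements merged into one kernel-verified Lean document; each statement's English description precedes it below -/
import Mathlib

section
/- Suppose that for every instance sequence ι ∈ I^V the family Rel(ι,·) is an admissible relaxation for the comparator class G(ι). Define the random-playout forecaster: at each round t ∈ {1,…,V}, having observed ι_1,…,ι_t and past labels y_1,…,y_{t−1}, it draws a completion ι' = (ι'_{t+1},…,ι'_V) from the conditional distribution μ(·|ι_1,…,ι_t) and plays any probability vector q̂_t(ι_{1:t}, y_{1:t−1}, ι') on [κ] minimizing q ↦ max_{y∈[κ]} [ (1 − q(y)) + Rel((ι_{1:t}, ι'), (y_1,…,y_{t−1},y)) ]. Then for every deterministic adaptive adversary, i.e. every family of functions Y_t : I^t → [κ] generating labels y_t(ι) = Y_t(ι_1,…,ι_t), the expected regret satisfies E_{ι∼μ} [ Σ_{t=1}^V E_{ι'∼μ(·|ι_{1:t})} (1 − q̂_t(ι_{1:t}, y_{1:t−1}(ι), ι')(y_t(ι))) − min_{f∈G(ι)} Σ_{t=1}^V 1{f(t)≠y_t(ι)} ] ≤ E_{ι∼μ} [ Rel(ι, ∅) ], where Rel(ι,∅) is the value at the empty label prefix. -/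
namespace Stmt1

/-- Conditional expectation, under the distribution `μ` on instance sequences,
of `f` given that the first `t` coordinates of the sequence equal those of `ι`
(the ratio defining the conditional expectation; by Lean's convention `x/0 = 0`
it takes the junk value `0` on prefixes of zero probability, which do not
contribute to any of the expectations below). -/
noncomputable def condExp {I : Type} [Fintype I] [DecidableEq I] (V : ℕ)
    (μ : (Fin V → I) → ℝ) (t : ℕ) (ι : Fin V → I) (f : (Fin V → I) → ℝ) : ℝ :=
  (∑ ι' : Fin V → I, if ∀ j : Fin V, (j : ℕ) < t → ι' j = ι j then μ ι' * f ι' else 0) /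
    (∑ ι' : Fin V → I, if ∀ j : Fin V, (j : ℕ) < t → ι' j = ι j then μ ι' else 0)

/-- Tower property: averaging conditional expectations of an integrand that depends on the
conditioning sequence only through its first `t` coordinates gives the plain expectation of
the diagonal. -/
theorem sum_mul_condExp {I : Type} [Fintype I] [DecidableEq I] (V : ℕ)
    (μ : (Fin V → I) → ℝ) (hμ0 : ∀ ι, 0 ≤ μ ι) (t : ℕ)
    (F : (Fin V → I) → (Fin V → I) → ℝ)
    (hF : ∀ ι ι' : Fin V → I, (∀ j : Fin V, (j : ℕ) < t → ι' j = ι j) → F ι = F ι') :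
    ∑ ι, μ ι * condExp V μ t ι (F ι) = ∑ ι, μ ι * F ι ι := by
  set D : (Fin V → I) → ℝ := fun ι =>
    ∑ ι' : Fin V → I, if ∀ j : Fin V, (j : ℕ) < t → ι' j = ι j then μ ι' else 0 with hD
  have hDcongr : ∀ ι ι' : Fin V → I, (∀ j : Fin V, (j : ℕ) < t → ι' j = ι j) →
      D ι = D ι' := by
    intro ι ι' h
    refine Finset.sum_congr rfl fun η _ => if_congr ?_ rfl rfl
    exact forall₂_congr fun j hj => by rw [h j hj]
  have hμD : ∀ ι, D ι = 0 → μ ι = 0 := by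
    intro ι h
    have hle : μ ι ≤ D ι := by
      have := Finset.single_le_sum
        (f := fun ι' => if ∀ j : Fin V, (j : ℕ) < t → ι' j = ι j then μ ι' else 0)
        (fun η _ => by split_ifs <;> simp [hμ0]) (Finset.mem_univ ι)
      simpa using this
    exact le_antisymm (h ▸ hle) (hμ0 ι)
  calc ∑ ι, μ ι * condExp V μ t ι (F ι)
      = ∑ ι, ∑ ι' : Fin V → I, if ∀ j : Fin V, (j : ℕ) < t → ι j = ι' j
          then μ ι * (μ ι' * F ι' ι' / D ι') else 0 := by
        refine Finset.sum_congr rfl fun ι _ => ?_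
        rw [condExp, Finset.sum_div, Finset.mul_sum]
        refine Finset.sum_congr rfl fun ι' _ => ?_
        by_cases h : ∀ j : Fin V, (j : ℕ) < t → ι' j = ι j
        · rw [if_pos h, if_pos fun j hj => (h j hj).symm, ← hDcongr ι ι' h, hF ι ι' h]
        · rw [if_neg h, if_neg fun h' => h fun j hj => (h' j hj).symm]
          simp
    _ = ∑ ι', D ι' * (μ ι' * F ι' ι' / D ι') := by
        rw [Finset.sum_comm]
        refine Finset.sum_congr rfl fun ι' _ => ?_
        rw [hD, Finset.sum_mul]
        exact Finset.sum_congr rfl fun ι _ => by rw [ite_mul, zero_mul]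
    _ = ∑ ι, μ ι * F ι ι := by
        refine Finset.sum_congr rfl fun ι _ => ?_
        by_cases h : D ι = 0
        · simp [hμD ι h]
        · exact mul_div_cancel₀ _ h

/-- Appending the next value to a prefix of a sequence gives the longer prefix. -/
theorem snoc_prefix {α : Type*} (y : ℕ → α) (t : ℕ) :
    (Fin.snoc (fun s : Fin t => y s) (y t) : Fin (t + 1) → α) = fun s : Fin (t + 1) => y s := by
  funext s
  refine Fin.lastCases ?_ (fun i => ?_) s <;> simp

/-- the random-playout forecaster built from a family of
admissible relaxations `Rel(ι, ·)` for the data-dependent classes `G(ι)` has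
expected regret at most `E_{ι∼μ} Rel(ι, ∅)` against every deterministic
adaptive adversary `Y`.  Rounds are 0-indexed: at round `t : Fin V` the
forecaster has observed the instance prefix of length `t+1` and the labels
`y_1, …, y_t`; the playout `ι'` ranges (via the conditional expectation) over
full sequences agreeing with `ι` on the first `t+1` coordinates, which combine
the observed prefix with the hallucinated completion. -/
theorem stmt_1 (V κ : ℕ) (hV : 0 < V) (hκ : 0 < κ)
    (I : Type) [Fintype I] [DecidableEq I] [Nonempty I]
    (μ : (Fin V → I) → ℝ) (hμ0 : ∀ ι, 0 ≤ μ ι) (hμ1 : ∑ ι, μ ι = 1)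
    (G : (Fin V → I) → Finset (Fin V → Fin κ)) (hG : ∀ ι, (G ι).Nonempty)
    (Rel : (Fin V → I) → (t : ℕ) → (Fin t → Fin κ) → ℝ)
    -- dominance condition of the admissible relaxation, for every `ι`
    (hdom : ∀ (ι : Fin V → I) (y : Fin V → Fin κ),
      Rel ι V y ≥ - (G ι).inf' (hG ι) (fun f => ∑ t, if f t ≠ y t then (1 : ℝ) else 0))
    -- recursive condition: the minimum over probability vectors is attained
    -- and is at most the relaxation at the shorter prefix
    (hrec : ∀ (ι : Fin V → I) (t : ℕ), t < V → ∀ ys : Fin t → Fin κ,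
      ∃ q : Fin κ → ℝ, (∀ k, 0 ≤ q k) ∧ (∑ k, q k = 1) ∧
        ∀ y : Fin κ, (1 - q y) + Rel ι (t + 1) (Fin.snoc ys y) ≤ Rel ι t ys)
    -- deterministic adaptive adversary
    (Y : (t : ℕ) → (Fin t → I) → Fin κ)
    -- the forecaster: a probability vector for each round, combined sequence
    -- (observed prefix + hallucinated completion) and past-label prefix …
    (qhat : (t : Fin V) → (Fin V → I) → (Fin (t : ℕ) → Fin κ) → Fin κ → ℝ)
    (hqhat0 : ∀ t ι' ys k, 0 ≤ qhat t ι' ys k)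
    (hqhat1 : ∀ t ι' ys, ∑ k, qhat t ι' ys k = 1)
    -- … minimizing `q ↦ max_y [(1 − q(y)) + Rel((ι_{1:t}, ι'), (y_{1:t−1}, y))]`
    (hqmin : ∀ (t : Fin V) (ι' : Fin V → I) (ys : Fin (t : ℕ) → Fin κ)
      (q : Fin κ → ℝ), (∀ k, 0 ≤ q k) → (∑ k, q k = 1) →
      Finset.univ.sup' ⟨⟨0, hκ⟩, Finset.mem_univ _⟩
          (fun y => (1 - qhat t ι' ys y) + Rel ι' ((t : ℕ) + 1) (Fin.snoc ys y))
        ≤ Finset.univ.sup' ⟨⟨0, hκ⟩, Finset.mem_univ _⟩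
          (fun y => (1 - q y) + Rel ι' ((t : ℕ) + 1) (Fin.snoc ys y))) :
    -- expected regret bound
    ∑ ι, μ ι *
        ((∑ t : Fin V, condExp V μ ((t : ℕ) + 1) ι (fun ι' =>
            1 - qhat t ι'
              (fun s : Fin (t : ℕ) => Y ((s : ℕ) + 1)
                (fun i => ι (Fin.castLE (Nat.succ_le_of_lt (lt_trans s.isLt t.isLt)) i)))
              (Y ((t : ℕ) + 1) (fun i => ι (Fin.castLE t.isLt i)))))
          - (G ι).inf' (hG ι) (fun f => ∑ t : Fin V,
              if f t ≠ Y ((t : ℕ) + 1) (fun i => ι (Fin.castLE t.isLt i)) then (1 : ℝ) else 0))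
      ≤ ∑ ι, μ ι * Rel ι 0 (fun i => i.elim0) := by
  let y : (Fin V → I) → Fin V → Fin κ :=
    fun ι t => Y ((t : ℕ) + 1) (fun i => ι (Fin.castLE t.isLt i))
  let ys : (Fin V → I) → (t : Fin V) → Fin (t : ℕ) → Fin κ :=
    fun ι t s => y ι ⟨s, s.isLt.trans t.isLt⟩
  have hyc : ∀ (ι ι' : Fin V → I) (n : ℕ), (∀ j : Fin V, (j : ℕ) < n → ι' j = ι j) →
      ∀ t : Fin V, (t : ℕ) < n → y ι t = y ι' t := by
    intro ι ι' n h t ht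
    refine congrArg (Y ((t : ℕ) + 1)) (funext fun i => (h _ ?_).symm)
    exact lt_of_lt_of_le i.isLt ht
  have htower : ∀ t : Fin V,
      ∑ ι, μ ι * condExp V μ ((t : ℕ) + 1) ι (fun ι' => 1 - qhat t ι' (ys ι t) (y ι t))
        = ∑ ι, μ ι * (1 - qhat t ι (ys ι t) (y ι t)) := by
    intro t
    refine sum_mul_condExp V μ hμ0 _ (fun ι ι' => 1 - qhat t ι' (ys ι t) (y ι t)) ?_
    intro ι ι' h
    have h₁ : y ι t = y ι' t := hyc ι ι' _ h t (Nat.lt_succ_self _)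
    have h₂ : ys ι t = ys ι' t :=
      funext fun s => hyc ι ι' _ h ⟨s, s.isLt.trans t.isLt⟩ (Nat.lt_succ_of_lt s.isLt)
    simp only [h₁, h₂]
  have hstep : ∀ (t : Fin V) (ι : Fin V → I) (zs : Fin (t : ℕ) → Fin κ) (z : Fin κ),
      (1 - qhat t ι zs z) + Rel ι ((t : ℕ) + 1) (Fin.snoc zs z) ≤ Rel ι t zs := by
    intro t ι zs z
    obtain ⟨q, hq0, hq1, hq⟩ := hrec ι t t.isLt zs
    refine le_trans ?_ ((hqmin t ι zs q hq0 hq1).trans (Finset.sup'_le _ _ fun k _ => hq k))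
    exact Finset.le_sup' (fun k => (1 - qhat t ι zs k) + Rel ι ((t : ℕ) + 1) (Fin.snoc zs k))
      (Finset.mem_univ z)
  have hpoint : ∀ ι : Fin V → I,
      ∑ t : Fin V, (1 - qhat t ι (ys ι t) (y ι t))
        - (G ι).inf' (hG ι) (fun f => ∑ t, if f t ≠ y ι t then (1 : ℝ) else 0)
        ≤ Rel ι 0 (fun i => i.elim0) := by
    intro ι
    let w : ℕ → Fin κ := fun n => if h : n < V then y ι ⟨n, h⟩ else ⟨0, hκ⟩
    have hw : ∀ t : Fin V, w t = y ι t := fun t => dif_pos t.isLt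
    let R : ℕ → ℝ := fun n => Rel ι n (fun s => w s)
    have hR : ∀ t : Fin V, 1 - qhat t ι (ys ι t) (y ι t) ≤ R t - R (t + 1) := by
      intro t
      have hws : (fun s : Fin (t : ℕ) => w s) = ys ι t :=
        funext fun s => hw ⟨s, s.isLt.trans t.isLt⟩
      have h := hstep t ι (fun s => w s) (w t)
      rw [snoc_prefix w t, hws, hw t, ← hws] at h
      rw [← hws]
      linarith
    have hsum : ∑ t : Fin V, (1 - qhat t ι (ys ι t) (y ι t)) ≤ R 0 - R V := by
      refine (Finset.sum_le_sum fun t _ => hR t).trans_eq ?_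
      rw [Fin.sum_univ_eq_sum_range (fun n => R n - R (n + 1)), Finset.sum_range_sub']
    have h0 : R 0 = Rel ι 0 (fun i => i.elim0) :=
      congrArg (Rel ι 0) (Subsingleton.elim _ _)
    have hV' : R V = Rel ι V (y ι) := congrArg (Rel ι V) (funext hw)
    linarith [hdom ι (y ι)]
  calc _ = ∑ ι, μ ι * (∑ t : Fin V, (1 - qhat t ι (ys ι t) (y ι t))
        - (G ι).inf' (hG ι) (fun f => ∑ t, if f t ≠ y ι t then (1 : ℝ) else 0)) := by
        have hsplit : ∀ a b : (Fin V → I) → ℝ,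
            ∑ ι, μ ι * (a ι - b ι) = ∑ ι, μ ι * a ι - ∑ ι, μ ι * b ι := fun a b => by
          simp only [mul_sub, Finset.sum_sub_distrib]
        have hswap : ∀ a : (Fin V → I) → Fin V → ℝ,
            ∑ ι, μ ι * ∑ t, a ι t = ∑ t, ∑ ι, μ ι * a ι t := fun a => by
          simp only [Finset.mul_sum]
          exact Finset.sum_comm
        rw [hsplit, hsplit, hswap, hswap]
        exact congrArg₂ _ (Finset.sum_congr rfl fun t _ => htower t) rfl
    _ ≤ _ := Finset.sum_le_sum fun ι _ => mul_le_mul_of_nonneg_left (hpoint ι) (hμ0 ι)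

end Stmt1
end

section
/- Let 𝓜 be a nonempty set of V×κ matrices with entries in [0,1] such that Σ_{k=1}^κ M_{t,k} ≤ 1 for every M ∈ 𝓜 and every row t. For a label prefix (y_1,…,y_t) ∈ [κ]^t define Rel(y_1,…,y_t) := 2^{−(V−t)κ} Σ_{ε∈{−1,1}^{(V−t)×κ}} sup_{M∈𝓜} [ 2 Σ_{j=t+1}^V Σ_{k=1}^κ ε_{j,k} M_{j,k} + Σ_{s=1}^t M_{s,y_s} ] − t. Then: (a) for every nonempty set G of label sequences such that M_f ∈ 𝓜 for all f ∈ G, and every (y_1,…,y_V) ∈ [κ]^V, one has Rel(y_1,…,y_V) ≥ −inf_{f∈G} Σ_{t=1}^V 1{f(t)≠y_t}; and (b) for every 1 ≤ t ≤ V and every (y_1,…,y_{t−1}) ∈ [κ]^{t−1}, if for each ε ∈ {−1,1}^{(V−t)×κ} one lets q̂(ε) be any probability vector on [κ] minimizing q ↦ max_{o∈[κ]} [ 1 − q(o) + sup_{M∈𝓜} ( 2 Σ_{j=t+1}^V Σ_{k=1}^κ ε_{j,k} M_{j,k} + M_{t,o} + Σ_{s=1}^{t−1} M_{s,y_s} )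 ], then max_{y∈[κ]} [ 2^{−(V−t)κ} Σ_{ε∈{−1,1}^{(V−t)×κ}} (1 − q̂(ε)(y)) + Rel(y_1,…,y_{t−1},y) ] ≤ Rel(y_1,…,y_{t−1}). In particular Rel is an admissible relaxation for any such class G, witnessed by the randomized strategy that draws ε uniformly at random and plays q̂(ε). -/
namespace Stmt2

/-- Rademacher sign of a Boolean. -/
def sg (b : Bool) : ℝ := if b then 1 else -1

/-- The Rademacher-based relaxation of the paper, evaluated at the label prefix
`ys` of length `t` (rounds/rows are 0-indexed, so the "future" rows are those
`j` with `t ≤ j`).  The average over the Rademacher signs of the future rows is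
written as an average over sign assignments of all `V × κ` entries; since the
summand does not depend on the signs of the first `t` rows, this equals the
average `2^{-(V-t)κ} Σ_{ε ∈ {−1,1}^{(V−t)×κ}}` of the statement. -/
noncomputable def relax (V κ : ℕ) (MM : Set (Fin V → Fin κ → ℝ))
    (t : ℕ) (h : t ≤ V) (ys : Fin t → Fin κ) : ℝ :=
  ((2 : ℝ) ^ (V * κ))⁻¹ * ∑ σ : Fin V × Fin κ → Bool,
      sSup ((fun M => 2 * ∑ j : Fin V, ∑ k : Fin κ,
            (if t ≤ (j : ℕ) then sg (σ (j, k)) * M j k else 0)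
          + ∑ s : Fin t, M (Fin.castLE h s) (ys s)) '' MM)
    - t

/-- The quantity `R_t(o)` of the paper at round `t+1` (0-indexed round `t`,
past labels `ys` of length `t`): future rows are those `j` with `t + 1 ≤ j`,
the current row is `t`, and the past rows carry the observed labels. -/
noncomputable def Robj (V κ : ℕ) (MM : Set (Fin V → Fin κ → ℝ))
    (t : ℕ) (ht : t < V) (ys : Fin t → Fin κ)
    (σ : Fin V × Fin κ → Bool) (o : Fin κ) : ℝ :=
  sSup ((fun M => 2 * ∑ j : Fin V, ∑ k : Fin κ,
        (if t + 1 ≤ (j : ℕ) then sg (σ (j, k)) * M j k else 0)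
      + M ⟨t, ht⟩ o + ∑ s : Fin t, M (Fin.castLE ht.le s) (ys s)) '' MM)

section LinearSup

variable {α ι : Type*} [Fintype ι]

/-- The supremum over `S` of an offset plus a linear functional of the feature `m`. -/
noncomputable def linSup (S : Set α) (Φ : α → ℝ) (m : α → ι → ℝ) (v : ι → ℝ) : ℝ :=
  sSup ((fun a => Φ a + ∑ k, v k * m a k) '' S)

variable {S : Set α} {Φ : α → ℝ} {m : α → ι → ℝ}

theorem linSup_le (hS : S.Nonempty) {v : ι → ℝ} {c : ℝ}
    (h : ∀ a ∈ S, Φ a + ∑ k, v k * m a k ≤ c) : linSup S Φ m v ≤ c := by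
  refine csSup_le (hS.image _) ?_
  rintro _ ⟨a, ha, rfl⟩
  exact h a ha

theorem le_linSup (hΦ : BddAbove (Φ '' S)) (hm : ∀ a ∈ S, ∀ k, m a k ∈ Set.Icc (0 : ℝ) 1)
    (v : ι → ℝ) {a : α} (ha : a ∈ S) : Φ a + ∑ k, v k * m a k ≤ linSup S Φ m v := by
  obtain ⟨C, hC⟩ := hΦ
  refine le_csSup ⟨C + ∑ k, |v k|, ?_⟩ ⟨a, ha, rfl⟩
  rintro _ ⟨b, hb, rfl⟩
  refine add_le_add (hC ⟨b, hb, rfl⟩) (Finset.sum_le_sum fun k _ => ?_)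
  obtain ⟨h0, h1⟩ := hm b hb k
  nlinarith [le_abs_self (v k), abs_nonneg (v k)]

theorem linSup_le_half_add (hS : S.Nonempty) (hΦ : BddAbove (Φ '' S))
    (hm : ∀ a ∈ S, ∀ k, m a k ∈ Set.Icc (0 : ℝ) 1) {u v w : ι → ℝ}
    (h : ∀ k, 2 * u k = v k + w k) :
    linSup S Φ m u ≤ (linSup S Φ m v + linSup S Φ m w) / 2 := by
  refine linSup_le hS fun a ha => ?_
  have hv := le_linSup hΦ hm v ha
  have hw := le_linSup hΦ hm w ha
  have : 2 * ∑ k, u k * m a k = ∑ k, v k * m a k + ∑ k, w k * m a k := by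
    rw [Finset.mul_sum, ← Finset.sum_add_distrib]
    exact Finset.sum_congr rfl fun k _ => by rw [← mul_assoc, h k, add_mul]
  linarith

theorem sg_not (b : Bool) : sg (!b) = -sg b := by cases b <;> simp [sg]

variable [DecidableEq ι]

/-- The average of `linSup` over all vectors with entries `±2`. -/
noncomputable def rademacherSup (S : Set α) (Φ : α → ℝ) (m : α → ι → ℝ) : ℝ :=
  ((2 : ℝ) ^ Fintype.card ι)⁻¹ * ∑ ε : ι → Bool, linSup S Φ m (fun k => 2 * sg (ε k))

theorem linSup_single_add_le_rademacherSup (hS : S.Nonempty) (hΦ : BddAbove (Φ '' S))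
    (hm : ∀ a ∈ S, ∀ k, m a k ∈ Set.Icc (0 : ℝ) 1) (o : ι) :
    linSup S Φ m (Pi.single o 2) + linSup S Φ m (Pi.single o (-2))
      ≤ 2 * rademacherSup S Φ m := by
  set H : (ι → Bool) → ℝ := fun ε => linSup S Φ m (fun k => 2 * sg (ε k)) with hH
  let flip (P : ι → Bool) : Equiv.Perm (ι → Bool) :=
    Function.Involutive.toPerm (fun ε k => xor (P k) (ε k)) fun ε => by ext k; simp
  have hflip_apply (P ε : ι → Bool) (k : ι) : flip P ε k = xor (P k) (ε k) := rfl
  have hflip (P : ι → Bool) : ∑ ε, H (flip P ε) = ∑ ε, H ε := Equiv.sum_comp (flip P) H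
  let only : ι → Bool := fun k => decide (k = o)
  let others : ι → Bool := fun k => decide (k ≠ o)
  let all : ι → Bool := fun _ => true
  have hsg (ε : ι → Bool) :
      linSup S Φ m (Pi.single o (2 * sg (ε o))) ≤ (H ε + H (flip others ε)) / 2 := by
    refine linSup_le_half_add hS hΦ hm fun k => ?_
    by_cases hk : k = o
    · subst hk
      simp [hflip_apply, others]
      ring
    · simp [hflip_apply, others, hk, sg_not]
  have hpoint (ε : ι → Bool) :
      linSup S Φ m (Pi.single o 2) + linSup S Φ m (Pi.single o (-2))
        ≤ (H ε + H (flip others ε)) / 2 + (H (flip all ε) + H (flip only ε)) / 2 := by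
    have h1 := hsg ε
    have h2 := hsg (flip all ε)
    have h3 : flip others (flip all ε) = flip only ε := by
      ext k
      by_cases hk : k = o <;> simp [hflip_apply, others, all, only, hk]
    rw [h3] at h2
    cases hb : ε o <;> simp [hb, sg, hflip_apply, all] at h1 h2 ⊢ <;> linarith
  have hsum := Finset.sum_le_sum fun ε (_ : ε ∈ Finset.univ) => hpoint ε
  simp only [Finset.sum_add_distrib, ← Finset.sum_div, hflip] at hsum
  simp only [Finset.sum_const, Finset.card_univ, Fintype.card_fun, Fintype.card_bool,
    nsmul_eq_mul] at hsum
  push_cast at hsum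
  have hpos : (0 : ℝ) < 2 ^ Fintype.card ι := by positivity
  rw [rademacherSup, ← mul_assoc, mul_comm 2, mul_assoc, ← div_eq_inv_mul, le_div_iff₀ hpos]
  simp only [hH] at hsum
  linarith

theorem sum_linSup_single_le (hS : S.Nonempty) (hΦ : BddAbove (Φ '' S))
    (hm : ∀ a ∈ S, ∀ k, m a k ∈ Set.Icc (0 : ℝ) 1) (hsum : ∀ a ∈ S, ∑ k, m a k ≤ 1)
    (A : Finset ι) :
    ∑ o ∈ A, (linSup S Φ m (Pi.single o 1) - rademacherSup S Φ m) ≤ 1 := by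
  rcases A.eq_empty_or_nonempty with rfl | hA
  · simp
  have hn : (0 : ℝ) < A.card := by exact_mod_cast hA.card_pos
  set P := ∑ o ∈ A, linSup S Φ m (Pi.single o 2) with hP
  set N := ∑ o ∈ A, linSup S Φ m (Pi.single o (-2)) with hN
  have hpoint (o : ι) : linSup S Φ m (Pi.single o 1)
      ≤ (A.card * linSup S Φ m (Pi.single o 2) + N + 2) / (2 * A.card) := by
    refine linSup_le hS fun a ha => ?_
    have h1 := le_linSup hΦ hm (Pi.single o 2) ha
    have h2 := Finset.sum_le_sum fun o' (_ : o' ∈ A) => le_linSup hΦ hm (Pi.single o' (-2)) ha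
    have h3 : ∑ k ∈ A, m a k ≤ 1 :=
      (Finset.sum_le_univ_sum_of_nonneg fun k => (hm a ha k).1).trans (hsum a ha)
    simp only [Pi.single_apply, ite_mul, zero_mul, Finset.sum_ite_eq', Finset.mem_univ, if_true,
      Finset.sum_add_distrib, Finset.sum_const, nsmul_eq_mul, ← Finset.mul_sum] at h1 h2 ⊢
    rw [le_div_iff₀ (by positivity)]
    have h4 := mul_le_mul_of_nonneg_left h1 hn.le
    simp only [hN] at h2 ⊢
    linarith
  have hR := Finset.sum_le_sum fun o (_ : o ∈ A) => hpoint o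
  rw [← Finset.sum_div] at hR
  simp only [Finset.sum_add_distrib, ← Finset.mul_sum, Finset.sum_const, nsmul_eq_mul] at hR
  rw [← hP, le_div_iff₀ (by positivity)] at hR
  have hB := Finset.sum_le_sum fun o (_ : o ∈ A) =>
    linSup_single_add_le_rademacherSup hS hΦ hm o
  simp only [Finset.sum_add_distrib, Finset.sum_const, nsmul_eq_mul] at hB
  rw [← hP, ← hN] at hB
  rw [Finset.sum_sub_distrib, Finset.sum_const, nsmul_eq_mul]
  refine le_of_mul_le_mul_left ?_ hn
  nlinarith [mul_le_mul_of_nonneg_left hB hn.le]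

end LinearSup

/-- A probability vector dominates `r` as soon as the sums of `r` over finite sets are at most
`1`. -/
theorem exists_probability_ge {ι : Type*} [Fintype ι] [Nonempty ι] (r : ι → ℝ)
    (h : ∀ A : Finset ι, ∑ o ∈ A, r o ≤ 1) :
    ∃ q : ι → ℝ, (∀ k, 0 ≤ q k) ∧ ∑ k, q k = 1 ∧ ∀ k, r k ≤ q k := by
  classical
  have hpos : ∑ k, max (r k) 0 ≤ 1 := by
    refine le_trans (le_of_eq ?_) (h (Finset.univ.filter fun k => 0 ≤ r k))
    rw [Finset.sum_filter]
    refine Finset.sum_congr rfl fun k _ => ?_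
    split_ifs with hk
    · exact max_eq_left hk
    · exact max_eq_right (not_le.mp hk).le
  obtain ⟨i⟩ := ‹Nonempty ι›
  have hs (k : ι) : 0 ≤ (Pi.single i (1 - ∑ k, max (r k) 0) : ι → ℝ) k := by
    rw [Pi.single_apply]
    split_ifs <;> linarith
  refine ⟨fun k => max (r k) 0 + (Pi.single i (1 - ∑ k, max (r k) 0) : ι → ℝ) k, fun k => ?_, ?_,
    fun k => ?_⟩
  · exact add_nonneg (le_max_right _ _) (hs k)
  · simp [Finset.sum_add_distrib]
  · linarith [hs k, le_max_left (r k) 0]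

/-- The payoff of the matrix `M` from the rows before `t` (observed labels `ys`) and after `t`
(signs `σ`). -/
noncomputable def offRowPayoff (V κ : ℕ) (t : ℕ) (ht : t < V) (ys : Fin t → Fin κ)
    (σ : Fin V × Fin κ → Bool) (M : Fin V → Fin κ → ℝ) : ℝ :=
  2 * ∑ j : Fin V, ∑ k : Fin κ, (if t + 1 ≤ (j : ℕ) then sg (σ (j, k)) * M j k else 0)
    + ∑ s : Fin t, M (Fin.castLE ht.le s) (ys s)

theorem bddAbove_offRowPayoff {V κ : ℕ} {MM : Set (Fin V → Fin κ → ℝ)}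
    (hM01 : ∀ M ∈ MM, ∀ t k, M t k ∈ Set.Icc (0 : ℝ) 1) (t : ℕ) (ht : t < V)
    (ys : Fin t → Fin κ) (σ : Fin V × Fin κ → Bool) :
    BddAbove (offRowPayoff V κ t ht ys σ '' MM) := by
  refine ⟨2 * ∑ _j : Fin V, ∑ _k : Fin κ, (1 : ℝ) + ∑ _s : Fin t, (1 : ℝ), ?_⟩
  rintro _ ⟨M, hM, rfl⟩
  unfold offRowPayoff
  gcongr with j _ k _ s _
  · obtain ⟨h0, h1⟩ := hM01 M hM j k
    split_ifs
    · cases σ (j, k) <;> simp [sg] <;> linarith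
    · exact zero_le_one
  · exact (hM01 M hM _ _).2

theorem Robj_eq_linSup (V κ : ℕ) (MM : Set (Fin V → Fin κ → ℝ)) (t : ℕ) (ht : t < V)
    (ys : Fin t → Fin κ) (σ : Fin V × Fin κ → Bool) (o : Fin κ) :
    Robj V κ MM t ht ys σ o
      = linSup MM (offRowPayoff V κ t ht ys σ) (fun M => M ⟨t, ht⟩) (Pi.single o 1) := by
  unfold Robj linSup
  congr 2
  ext M
  simp only [offRowPayoff, Pi.single_apply, ite_mul, zero_mul, one_mul, Finset.sum_ite_eq',
    Finset.mem_univ, if_true]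
  ring

theorem relax_succ_eq (V κ : ℕ) (MM : Set (Fin V → Fin κ → ℝ)) (t : ℕ) (ht : t < V)
    (ys : Fin t → Fin κ) (y : Fin κ) :
    relax V κ MM (t + 1) ht (Fin.snoc ys y)
      = ((2 : ℝ) ^ (V * κ))⁻¹ * ∑ σ, Robj V κ MM t ht ys σ y - (t + 1) := by
  unfold relax Robj
  push_cast
  congr 3
  ext σ
  congr 2
  ext M
  rw [Fin.sum_univ_castSucc]
  simp only [Fin.snoc_castSucc, Fin.snoc_last, Fin.castLE_castSucc]
  have : Fin.castLE (Nat.succ_le_of_lt ht) (Fin.last t) = ⟨t, ht⟩ := rfl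
  rw [this]
  ring

theorem relax_eq_sum_linSup (V κ : ℕ) (MM : Set (Fin V → Fin κ → ℝ)) (t : ℕ) (ht : t < V)
    (ys : Fin t → Fin κ) :
    relax V κ MM t ht.le ys
      = ((2 : ℝ) ^ (V * κ))⁻¹ * ∑ σ : Fin V × Fin κ → Bool,
          linSup MM (offRowPayoff V κ t ht ys σ) (fun M => M ⟨t, ht⟩)
            (fun k => 2 * sg (σ (⟨t, ht⟩, k))) - t := by
  unfold relax linSup
  congr 3
  ext σ
  congr 2
  ext M
  have hsplit : ∑ j : Fin V, ∑ k : Fin κ, (if t ≤ (j : ℕ) then sg (σ (j, k)) * M j k else 0)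
      = ∑ j : Fin V, ∑ k : Fin κ, (if t + 1 ≤ (j : ℕ) then sg (σ (j, k)) * M j k else 0)
        + ∑ k, sg (σ (⟨t, ht⟩, k)) * M ⟨t, ht⟩ k := by
    rw [← Finset.sum_ite_eq' Finset.univ (⟨t, ht⟩ : Fin V)
      (fun j => ∑ k, sg (σ (j, k)) * M j k) |>.trans (if_pos (Finset.mem_univ _)),
      ← Finset.sum_add_distrib]
    refine Finset.sum_congr rfl fun j _ => ?_
    rcases lt_trichotomy (j : ℕ) t with hj | hj | hj
    · have : j ≠ ⟨t, ht⟩ := fun h => by simp [h] at hj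
      simp [this, not_le.mpr hj, not_le.mpr (hj.trans t.lt_succ_self)]
    · have : j = ⟨t, ht⟩ := Fin.ext hj
      simp [this]
    · have : j ≠ ⟨t, ht⟩ := fun h => by simp [h] at hj
      simp [this, hj.le, Nat.succ_le_of_lt hj]
  simp only [offRowPayoff, hsplit, mul_assoc, ← Finset.mul_sum]
  ring

/-- Averaging over the signs of row `t` separately does not change the average over all signs. -/
theorem sum_linSup_eq_sum_rademacherSup (V κ : ℕ) (MM : Set (Fin V → Fin κ → ℝ)) (t : ℕ)
    (ht : t < V) (ys : Fin t → Fin κ) :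
    ∑ σ : Fin V × Fin κ → Bool,
        linSup MM (offRowPayoff V κ t ht ys σ) (fun M => M ⟨t, ht⟩)
          (fun k => 2 * sg (σ (⟨t, ht⟩, k)))
      = ∑ σ : Fin V × Fin κ → Bool,
          rademacherSup MM (offRowPayoff V κ t ht ys σ) (fun M => M ⟨t, ht⟩) := by
  set T : (Fin V × Fin κ → Bool) → ℝ := fun σ =>
    linSup MM (offRowPayoff V κ t ht ys σ) (fun M => M ⟨t, ht⟩)
      (fun k => 2 * sg (σ (⟨t, ht⟩, k))) with hT
  let twist (ε : Fin κ → Bool) : Equiv.Perm (Fin V × Fin κ → Bool) :=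
    Function.Involutive.toPerm
      (fun σ p => if p.1 = ⟨t, ht⟩ then xor (σ p) (ε p.2) else σ p) fun σ => by
        ext p
        by_cases hp : p.1 = ⟨t, ht⟩ <;> simp [hp]
  let shift (δ : Fin κ → Bool) : Equiv.Perm (Fin κ → Bool) :=
    Function.Involutive.toPerm (fun ε k => xor (δ k) (ε k)) fun ε => by ext k; simp
  have htwist (ε : Fin κ → Bool) (σ : Fin V × Fin κ → Bool) (p : Fin V × Fin κ) :
      twist ε σ p = if p.1 = ⟨t, ht⟩ then xor (σ p) (ε p.2) else σ p := rfl
  have hshift (δ ε : Fin κ → Bool) (k : Fin κ) : shift δ ε k = xor (δ k) (ε k) := rfl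
  have hoff (ε : Fin κ → Bool) (σ : Fin V × Fin κ → Bool) :
      offRowPayoff V κ t ht ys (twist ε σ) = offRowPayoff V κ t ht ys σ := by
    ext M
    unfold offRowPayoff
    congr 2
    refine Finset.sum_congr rfl fun j _ => Finset.sum_congr rfl fun k _ => ?_
    split_ifs with hj
    · have : j ≠ ⟨t, ht⟩ := fun h => by simp [h] at hj
      simp [htwist, this]
    · rfl
  have hrad (σ : Fin V × Fin κ → Bool) :
      rademacherSup MM (offRowPayoff V κ t ht ys σ) (fun M => M ⟨t, ht⟩)
        = ((2 : ℝ) ^ κ)⁻¹ * ∑ ε : Fin κ → Bool, T (twist ε σ) := by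
    rw [rademacherSup, Fintype.card_fin]
    congr 1
    rw [← Equiv.sum_comp (shift fun k => σ (⟨t, ht⟩, k))]
    refine Finset.sum_congr rfl fun ε _ => ?_
    simp only [hT, hoff]
    simp [htwist, hshift]
  simp only [hrad, ← Finset.mul_sum]
  rw [Finset.sum_comm]
  simp only [fun ε => Equiv.sum_comp (twist ε) T]
  simp

/-- the Rademacher-based relaxation built from a set `MM` of
`[0,1]`-valued `V × κ` matrices with row sums at most `1` satisfies
(a) the dominance condition for every nonempty finite class `G` of label
sequences whose assignment matrices lie in `MM`, and (b) the recursive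
admissibility condition, witnessed by any `q̂(ε)` minimizing the described
objective.  Hence it is an admissible relaxation for every such class `G`. -/
theorem stmt_2 (V κ : ℕ) (hV : 0 < V) (hκ : 0 < κ)
    (MM : Set (Fin V → Fin κ → ℝ)) (hMne : MM.Nonempty)
    (hM01 : ∀ M ∈ MM, ∀ t k, M t k ∈ Set.Icc (0 : ℝ) 1)
    (hMrow : ∀ M ∈ MM, ∀ t, ∑ k, M t k ≤ 1) :
    -- (a) dominance
    (∀ (G : Finset (Fin V → Fin κ)) (hG : G.Nonempty),
      (∀ f ∈ G, (fun t k => if f t = k then (1 : ℝ) else 0) ∈ MM) →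
      ∀ y : Fin V → Fin κ,
        relax V κ MM V le_rfl y
          ≥ - G.inf' hG (fun f => ∑ t, if f t ≠ y t then (1 : ℝ) else 0))
    ∧
    -- (b) recursive admissibility of the minimizing randomized strategy
    (∀ (t : ℕ) (ht : t < V) (ys : Fin t → Fin κ)
      (qhat : (Fin V × Fin κ → Bool) → Fin κ → ℝ),
      (∀ σ k, 0 ≤ qhat σ k) → (∀ σ, ∑ k, qhat σ k = 1) →
      (∀ (σ : Fin V × Fin κ → Bool) (q : Fin κ → ℝ),
        (∀ k, 0 ≤ q k) → (∑ k, q k = 1) →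
        Finset.univ.sup' ⟨⟨0, hκ⟩, Finset.mem_univ _⟩
            (fun o => 1 - qhat σ o + Robj V κ MM t ht ys σ o)
          ≤ Finset.univ.sup' ⟨⟨0, hκ⟩, Finset.mem_univ _⟩
            (fun o => 1 - q o + Robj V κ MM t ht ys σ o)) →
      Finset.univ.sup' ⟨⟨0, hκ⟩, Finset.mem_univ _⟩ (fun y : Fin κ =>
          ((2 : ℝ) ^ (V * κ))⁻¹ * (∑ σ : Fin V × Fin κ → Bool, (1 - qhat σ y))
            + relax V κ MM (t + 1) ht (Fin.snoc ys y))
        ≤ relax V κ MM t ht.le ys) := by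
  constructor
  · intro G hG hGM y
    obtain ⟨f, hf, hfeq⟩ := G.exists_mem_eq_inf' hG
      (fun f => ∑ t, if f t ≠ y t then (1 : ℝ) else 0)
    rw [hfeq, ge_iff_le]
    have hsup : ∑ s : Fin V, (if f s = y s then (1 : ℝ) else 0)
        ≤ sSup ((fun M : Fin V → Fin κ → ℝ => ∑ s, M s (y s)) '' MM) := by
      refine le_csSup ⟨∑ _s : Fin V, (1 : ℝ), ?_⟩ ⟨_, hGM f hf, rfl⟩
      rintro _ ⟨M, hM, rfl⟩
      exact Finset.sum_le_sum fun s _ => (hM01 M hM _ _).2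
    have hcount : ∑ s, (if f s ≠ y s then (1 : ℝ) else 0)
        = V - ∑ s, (if f s = y s then (1 : ℝ) else 0) := by
      rw [eq_sub_iff_add_eq, ← Finset.sum_add_distrib]
      trans ∑ _s : Fin V, (1 : ℝ)
      · refine Finset.sum_congr rfl fun s _ => ?_
        by_cases h : f s = y s <;> simp [h]
      · simp
    have hrelax : relax V κ MM V le_rfl y
        = sSup ((fun M : Fin V → Fin κ → ℝ => ∑ s, M s (y s)) '' MM) - V := by
      simp [relax, not_le.mpr (Fin.is_lt _)]
    rw [hrelax, hcount]
    linarith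
  · intro t ht ys qhat _ _ hmin
    have : Nonempty (Fin κ) := ⟨⟨0, hκ⟩⟩
    refine Finset.sup'_le _ _ fun y _ => ?_
    have hpoint (σ : Fin V × Fin κ → Bool) :
        1 - qhat σ y + Robj V κ MM t ht ys σ y
          ≤ 1 + rademacherSup MM (offRowPayoff V κ t ht ys σ) (fun M => M ⟨t, ht⟩) := by
      obtain ⟨q, hq0, hq1, hq⟩ := exists_probability_ge _ <| sum_linSup_single_le hMne (bddAbove_offRowPayoff hM01 t ht ys σ)
          (fun M hM => hM01 M hM ⟨t, ht⟩) (fun M hM => hMrow M hM ⟨t, ht⟩)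
      refine (Finset.le_sup' (fun o => 1 - qhat σ o + Robj V κ MM t ht ys σ o)
        (Finset.mem_univ y)).trans ((hmin σ q hq0 hq1).trans ?_)
      refine Finset.sup'_le _ _ fun o _ => ?_
      rw [Robj_eq_linSup]
      linarith [hq o]
    have hsum := Finset.sum_le_sum fun σ (_ : σ ∈ Finset.univ) => hpoint σ
    rw [Finset.sum_add_distrib, Finset.sum_add_distrib] at hsum
    have hone : ((2 : ℝ) ^ (V * κ))⁻¹ * ∑ _σ : Fin V × Fin κ → Bool, (1 : ℝ) = 1 := by simp
    have havg := mul_le_mul_of_nonneg_left hsum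
      (by positivity : (0 : ℝ) ≤ ((2 : ℝ) ^ (V * κ))⁻¹)
    rw [mul_add, mul_add, hone] at havg
    rw [relax_succ_eq, relax_eq_sum_linSup V κ MM t ht, sum_linSup_eq_sum_rademacherSup]
    linarith

end Stmt2
end

section
/- Let κ be a positive integer, S a nonempty set, h : S → ℝ a function bounded above, and a : S → ℝ^κ a bounded function, with a_k(s) denoting the k-th coordinate of a(s). Then max_{y∈[κ]} (1/2) Σ_{δ∈{−1,1}} sup_{s∈S} [ h(s) + 2 δ a_y(s) ] ≤ 2^{−κ} Σ_{ε∈{−1,1}^κ} sup_{s∈S} [ h(s) + 2 Σ_{k=1}^κ ε_k a_k(s) ]. -/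
/-- The real sign `1` or `-1` attached to a Boolean changes sign under negation. -/
lemma ite_not_one_neg_one (b : Bool) :
    (if !b then (1 : ℝ) else -1) = -(if b then (1 : ℝ) else -1) := by
  cases b <;> simp

/-- Averaging a function of a single coordinate over the Boolean cube. -/
lemma two_mul_sum_bool_cube_apply {ι : Type*} [Fintype ι] [DecidableEq ι] (F : Bool → ℝ) (y : ι) :
    2 * ∑ σ : ι → Bool, F (σ y) = (2 : ℝ) ^ Fintype.card ι * ∑ δ : Bool, F δ := by
  have hinv : Function.Involutive (fun (σ : ι → Bool) k => !(σ k)) := fun σ => by simp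
  have hflip : ∑ σ : ι → Bool, F (!(σ y)) = ∑ σ : ι → Bool, F (σ y) :=
    Equiv.sum_comp hinv.toPerm fun σ : ι → Bool => F (σ y)
  have hpt (σ : ι → Bool) : F (σ y) + F (!(σ y)) = ∑ δ : Bool, F δ := by
    cases σ y <;> simp [add_comm]
  calc 2 * ∑ σ : ι → Bool, F (σ y)
      = ∑ σ : ι → Bool, (F (σ y) + F (!(σ y))) := by
        rw [Finset.sum_add_distrib, hflip, two_mul]
    _ = (2 : ℝ) ^ Fintype.card ι * ∑ δ : Bool, F δ := by
        simp only [hpt, Finset.sum_const, Finset.card_univ, Fintype.card_fun, Fintype.card_bool,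
          nsmul_eq_mul, Nat.cast_pow, Nat.cast_ofNat]

/-- A function bounded above plus a Rademacher sum of bounded functions is bounded above. -/
lemma bddAbove_range_add_sign_sum {ι S : Type*} [Fintype ι] {h : S → ℝ}
    (hb : BddAbove (Set.range h)) {a : S → ι → ℝ} {C : ℝ} (ha : ∀ s k, |a s k| ≤ C)
    (σ : ι → Bool) :
    BddAbove (Set.range fun s => h s + 2 * ∑ k, (if σ k then (1 : ℝ) else -1) * a s k) := by
  obtain ⟨B, hB⟩ := hb
  refine ⟨B + 2 * ∑ _k : ι, C, ?_⟩
  rintro _ ⟨s, rfl⟩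
  have hsum : ∑ k, (if σ k then (1 : ℝ) else -1) * a s k ≤ ∑ _k : ι, C := by
    refine Finset.sum_le_sum fun k _ => ?_
    have := abs_le.mp (ha s k)
    split_ifs <;> linarith
  have := hB ⟨s, rfl⟩
  dsimp only
  linarith

/-- the key symmetrization step.  The max over the adversary's
label `y` of the average over a single Rademacher sign `δ` applied to the `y`-th
coordinate is dominated by the uniform average over a full Rademacher vector
`ε ∈ {−1,1}^κ` applied to all `κ` coordinates. -/
theorem stmt_3 (κ : ℕ) (hκ : 0 < κ) (S : Type*) [Nonempty S]
    (h : S → ℝ) (hb : BddAbove (Set.range h))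
    (a : S → Fin κ → ℝ) (C : ℝ) (ha : ∀ s k, |a s k| ≤ C) :
    Finset.univ.sup' ⟨⟨0, hκ⟩, Finset.mem_univ _⟩ (fun y : Fin κ =>
        (1 / 2 : ℝ) * ∑ δ : Bool, ⨆ s : S, (h s + 2 * (if δ then (1 : ℝ) else -1) * a s y))
      ≤ ((2 : ℝ) ^ κ)⁻¹ * ∑ σ : Fin κ → Bool,
          ⨆ s : S, (h s + 2 * ∑ k, (if σ k then (1 : ℝ) else -1) * a s k) := by
  refine Finset.sup'_le _ _ fun y _ => ?_
  set F : Bool → ℝ := fun δ => ⨆ s : S, (h s + 2 * (if δ then (1 : ℝ) else -1) * a s y) with hF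
  set G : (Fin κ → Bool) → ℝ := fun σ =>
    ⨆ s : S, (h s + 2 * ∑ k, (if σ k then (1 : ℝ) else -1) * a s k) with hG
  have hle (σ : Fin κ → Bool) (s : S) :
      h s + 2 * ∑ k, (if σ k then (1 : ℝ) else -1) * a s k ≤ G σ :=
    le_ciSup (bddAbove_range_add_sign_sum hb ha σ) s
  let flip : (Fin κ → Bool) → Fin κ → Bool := fun σ k => if k = y then σ k else !(σ k)
  have hinv : Function.Involutive flip := fun σ => by
    funext k
    by_cases hk : k = y <;> simp [flip, hk]
  have hpair (σ : Fin κ → Bool) : 2 * F (σ y) ≤ G σ + G (flip σ) := by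
    suffices F (σ y) ≤ (G σ + G (flip σ)) / 2 by linarith
    refine ciSup_le fun s => ?_
    have hsum : ∑ k, (if σ k then (1 : ℝ) else -1) * a s k
        + ∑ k, (if flip σ k then (1 : ℝ) else -1) * a s k
        = 2 * ((if σ y then (1 : ℝ) else -1) * a s y) := by
      rw [← Finset.sum_add_distrib, Finset.sum_eq_single y]
      · simp only [flip, if_true]
        ring
      · intro k _ hk
        simp only [flip, if_neg hk, ite_not_one_neg_one]
        ring
      · simp
    linarith [hle σ s, hle (flip σ) s]
  have hflip : ∑ σ, G (flip σ) = ∑ σ, G σ := Equiv.sum_comp hinv.toPerm G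
  have htotal : 2 * ∑ σ : Fin κ → Bool, F (σ y) ≤ 2 * ∑ σ, G σ := by
    calc 2 * ∑ σ : Fin κ → Bool, F (σ y) = ∑ σ : Fin κ → Bool, 2 * F (σ y) := Finset.mul_sum ..
      _ ≤ ∑ σ, (G σ + G (flip σ)) := Finset.sum_le_sum fun σ _ => hpair σ
      _ = 2 * ∑ σ, G σ := by rw [Finset.sum_add_distrib, hflip, two_mul]
  rw [two_mul_sum_bool_cube_apply, Fintype.card_fin] at htotal
  rw [le_inv_mul_iff₀ (by positivity)]
  linarith
end

section
/- Let I be a nonempty finite set, μ a probability distribution on I^V, and for each ι ∈ I^V let G(ι) be a nonempty finite set of label sequences and 𝓜(ι) a nonempty set of V×κ matrices with entries in [0,1] and row sums at most 1 such that M_f ∈ 𝓜(ι) for every f ∈ G(ι). Consider the forecaster that at round t, having observed ι_1,…,ι_t and past labels y_1,…,y_{t−1}, draws a completion ι' = (ι'_{t+1},…,ι'_V) ∼ μ(·|ι_{1:t}) and, independently, a uniform ε ∈ {−1,1}^{(V−t)×κ}, computes for each o ∈ [κ] the value R_t(o) = sup_{M ∈ 𝓜((ι_{1:t},ι'))} [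 2 Σ_{j=t+1}^V Σ_{k=1}^κ ε_{j,k} M_{j,k} + M_{t,o} + Σ_{s=1}^{t−1} M_{s,y_s} ], and plays any probability vector q̂ on [κ] minimizing q ↦ max_{o∈[κ]} [ 1 − q(o) + R_t(o) ]. Then for every deterministic adaptive adversary, i.e. every family of functions Y_t : I^t → [κ] generating labels y_t(ι) = Y_t(ι_1,…,ι_t), the expected regret satisfies E_{ι∼μ} [ Σ_{t=1}^V E_{ι'∼μ(·|ι_{1:t})} E_{ε} (1 − q̂(ι_{1:t},y_{1:t−1}(ι),ι',ε)(y_t(ι))) − min_{f∈G(ι)} Σ_{t=1}^V 1{f(t)≠y_t(ι)} ] ≤ 2 · E_{ι∼μ} Rad(𝓜(ι)). -/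
namespace Stmt4

/-- Rademacher sign of a Boolean. -/
def sg (b : Bool) : ℝ := if b then 1 else -1

/-- Conditional expectation, under the distribution `μ` on instance sequences,
of `f` given that the first `t` coordinates of the sequence equal those of `ι`
(by Lean's convention `x/0 = 0` it takes the junk value `0` on prefixes of zero
probability, which do not contribute to any expectation below). -/
noncomputable def condExp {I : Type} [Fintype I] [DecidableEq I] (V : ℕ)
    (μ : (Fin V → I) → ℝ) (t : ℕ) (ι : Fin V → I) (f : (Fin V → I) → ℝ) : ℝ :=
  (∑ ι' : Fin V → I, if ∀ j : Fin V, (j : ℕ) < t → ι' j = ι j then μ ι' * f ι' else 0) /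
    (∑ ι' : Fin V → I, if ∀ j : Fin V, (j : ℕ) < t → ι' j = ι j then μ ι' else 0)

/-- The Rademacher complexity `Rad(N)` of a set `N` of real `V × κ` matrices,
written as a uniform average over sign assignments of all entries. -/
noncomputable def radSet (V κ : ℕ) (N : Set (Fin V → Fin κ → ℝ)) : ℝ :=
  ((2 : ℝ) ^ (V * κ))⁻¹ * ∑ σ : Fin V × Fin κ → Bool,
    sSup ((fun M => ∑ t : Fin V, ∑ k : Fin κ, sg (σ (t, k)) * M t k) '' N)

/-- The quantity `R_t(o)` of the paper at 0-indexed round `t` (past labels `ys`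
of length `t`): future rows are those `j` with `t + 1 ≤ j`, the current row is
`t`, and the past rows carry the observed labels.  Since the expression does
not depend on the signs of the first `t + 1` rows of `σ`, averaging over all of
`σ` equals the stated average over `ε ∈ {−1,1}^{(V−t−1)×κ}`. -/
noncomputable def Robj (V κ : ℕ) (N : Set (Fin V → Fin κ → ℝ))
    (t : ℕ) (ht : t < V) (ys : Fin t → Fin κ)
    (σ : Fin V × Fin κ → Bool) (o : Fin κ) : ℝ :=
  sSup ((fun M => 2 * ∑ j : Fin V, ∑ k : Fin κ,
        (if t + 1 ≤ (j : ℕ) then sg (σ (j, k)) * M j k else 0)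
      + M ⟨t, ht⟩ o + ∑ s : Fin t, M (Fin.castLE ht.le s) (ys s)) '' N)

lemma sum_mul_condExp {I : Type} [Fintype I] [DecidableEq I] (V : ℕ)
    (μ : (Fin V → I) → ℝ) (hμ0 : ∀ ι, 0 ≤ μ ι) (t : ℕ)
    (F : (Fin V → I) → (Fin V → I) → ℝ)
    (hF : ∀ ι ι', (∀ j : Fin V, (j : ℕ) < t → ι' j = ι j) → F ι ι' = F ι' ι') :
    ∑ ι, μ ι * condExp V μ t ι (F ι) = ∑ ι, μ ι * F ι ι := by
  set Z : (Fin V → I) → ℝ := fun ι =>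
    ∑ ι' : Fin V → I, if ∀ j : Fin V, (j : ℕ) < t → ι' j = ι j then μ ι' else 0 with hZ
  have hZcongr : ∀ ι ι' : Fin V → I, (∀ j : Fin V, (j : ℕ) < t → ι' j = ι j) → Z ι = Z ι' := by
    intro ι ι' h
    refine Finset.sum_congr rfl fun x _ => ?_
    have : (∀ j : Fin V, (j : ℕ) < t → x j = ι j) ↔ (∀ j : Fin V, (j : ℕ) < t → x j = ι' j) :=
      forall_congr' fun j => imp_congr_right fun hj => by rw [h j hj]
    simp only [this]
  have hZle : ∀ ι, μ ι ≤ Z ι := by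
    intro ι
    have h := Finset.single_le_sum
      (f := fun ι' : Fin V → I =>
        if ∀ j : Fin V, (j : ℕ) < t → ι' j = ι j then μ ι' else 0)
      (fun i _ => by split_ifs <;> simp [hμ0]) (Finset.mem_univ ι)
    simpa using h
  have hcond : ∀ ι, μ ι * condExp V μ t ι (F ι) = ∑ ι' : Fin V → I,
      if ∀ j : Fin V, (j : ℕ) < t → ι j = ι' j then μ ι / Z ι' * (μ ι' * F ι' ι') else 0 := by
    intro ι
    change μ ι * (_ / Z ι) = _
    rw [← mul_div_assoc, mul_div_right_comm, Finset.mul_sum]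
    refine Finset.sum_congr rfl fun ι' _ => ?_
    by_cases h : ∀ j : Fin V, (j : ℕ) < t → ι' j = ι j
    · rw [if_pos h, if_pos fun j hj => (h j hj).symm, hF ι ι' h, hZcongr ι ι' h]
    · rw [if_neg h, if_neg fun h' => h fun j hj => (h' j hj).symm, mul_zero]
  simp_rw [hcond]
  rw [Finset.sum_comm]
  refine Finset.sum_congr rfl fun ι' _ => ?_
  have hfac : ∀ ι : Fin V → I,
      (if ∀ j : Fin V, (j : ℕ) < t → ι j = ι' j then μ ι / Z ι' * (μ ι' * F ι' ι') else 0)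
        = (if ∀ j : Fin V, (j : ℕ) < t → ι j = ι' j then μ ι else 0)
            * ((Z ι')⁻¹ * (μ ι' * F ι' ι')) := by
    intro ι
    split_ifs <;> ring
  simp_rw [hfac]
  rw [← Finset.sum_mul]
  change Z ι' * _ = _
  by_cases h0 : Z ι' = 0
  · have : μ ι' = 0 := le_antisymm (h0 ▸ hZle ι') (hμ0 ι')
    simp [this]
  · rw [mul_inv_cancel_left₀ h0]

lemma sg_mul_self (b : Bool) : sg b * sg b = 1 := by cases b <;> norm_num [sg]

lemma sg_not (b : Bool) : sg (!b) = -sg b := by cases b <;> norm_num [sg]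

lemma abs_sg (b : Bool) : |sg b| = 1 := by cases b <;> norm_num [sg]

lemma sum_eq_zero_of_flip {K : Type*} [Fintype K] [DecidableEq K] (k : K)
    (g : (K → Bool) → ℝ) (hg : ∀ ρ, g (Function.update ρ k (!ρ k)) = -g ρ) :
    ∑ ρ, g ρ = 0 := by
  have hinv : Function.Involutive (fun ρ : K → Bool => Function.update ρ k (!ρ k)) := by
    intro ρ
    simp
  have h := Equiv.sum_comp hinv.toPerm g
  simp only [Function.Involutive.coe_toPerm, hg, Finset.sum_neg_distrib] at h
  linarith

lemma sum_sg {K : Type*} [Fintype K] [DecidableEq K] (k : K) :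
    ∑ ρ : K → Bool, sg (ρ k) = 0 :=
  sum_eq_zero_of_flip k _ fun ρ => by simp [sg_not]

lemma sum_sg_mul_sg {K : Type*} [Fintype K] [DecidableEq K] (k o : K) :
    ∑ ρ : K → Bool, sg (ρ k) * sg (ρ o) = if k = o then (2 : ℝ) ^ Fintype.card K else 0 := by
  split_ifs with h
  · subst h
    simp [sg_mul_self]
  · exact sum_eq_zero_of_flip k _ fun ρ => by
      simp [sg_not, Function.update_of_ne (Ne.symm h)]

/-- Weighting a Rademacher average by the density `1 + s * ε_o` isolates the coordinate `o`. -/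
lemma sum_one_add_sg_mul {K : Type*} [Fintype K] [DecidableEq K] (s : ℝ) (o : K)
    (v : K → ℝ) (x : ℝ) :
    ∑ ρ : K → Bool, (1 + s * sg (ρ o)) * (2 * ∑ k, sg (ρ k) * v k + x)
      = (2 : ℝ) ^ Fintype.card K * (2 * s * v o + x) := by
  have h1 : ∑ ρ : K → Bool, ∑ k, sg (ρ k) * v k = 0 := by
    rw [Finset.sum_comm]
    simp [← Finset.sum_mul, sum_sg]
  have h2 : ∑ ρ : K → Bool, ∑ k, (sg (ρ k) * sg (ρ o)) * v k
      = (2 : ℝ) ^ Fintype.card K * v o := by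
    rw [Finset.sum_comm]
    simp [← Finset.sum_mul, sum_sg_mul_sg]
  have h3 : ∀ ρ : K → Bool, (1 + s * sg (ρ o)) * (2 * ∑ k, sg (ρ k) * v k + x)
      = 2 * ∑ k, sg (ρ k) * v k + 2 * s * ∑ k, (sg (ρ k) * sg (ρ o)) * v k
        + x + s * x * sg (ρ o) := by
    intro ρ
    have : ∑ k, (sg (ρ k) * sg (ρ o)) * v k = sg (ρ o) * ∑ k, sg (ρ k) * v k := by
      rw [Finset.mul_sum]
      exact Finset.sum_congr rfl fun k _ => by ring
    rw [this]
    ring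
  simp_rw [h3, Finset.sum_add_distrib, ← Finset.mul_sum, h1, h2, sum_sg]
  simp
  ring

/-- Value of the one-round game: some mixed prediction keeps `1 - q o + R o` below
one plus the Rademacher average of `W`. -/
lemma exists_prob_le {K α : Type*} [Fintype K] [DecidableEq K] [Nonempty K]
    (N : Set α) (hN : N.Nonempty) (v : α → K → ℝ) (Φ : α → ℝ)
    (hv0 : ∀ M ∈ N, ∀ k, 0 ≤ v M k) (hv1 : ∀ M ∈ N, ∑ k, v M k ≤ 1)
    (W : (K → Bool) → ℝ)
    (hW : ∀ M ∈ N, ∀ ρ, 2 * ∑ k, sg (ρ k) * v M k + Φ M ≤ W ρ)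
    (R : K → ℝ) (hR : ∀ o, R o = sSup ((fun M => v M o + Φ M) '' N)) :
    ∃ q : K → ℝ, (∀ k, 0 ≤ q k) ∧ ∑ k, q k = 1 ∧
      ∀ o, 1 - q o + R o ≤ 1 + ((2 : ℝ) ^ Fintype.card K)⁻¹ * ∑ ρ, W ρ := by
  set c : ℝ := ((2 : ℝ) ^ Fintype.card K)⁻¹ * ∑ ρ, W ρ with hc
  set P : ℝ := (2 : ℝ) ^ Fintype.card K with hP
  have hPpos : 0 < P := by positivity
  set b : ℝ → K → ℝ := fun s o => P⁻¹ * ∑ ρ, (1 + s * sg (ρ o)) * W ρ with hb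
  have hble : ∀ s : ℝ, |s| ≤ 1 → ∀ o, ∀ M ∈ N, 2 * s * v M o + Φ M ≤ b s o := by
    intro s hs o M hM
    rw [hb]
    dsimp only
    rw [le_inv_mul_iff₀ hPpos, ← sum_one_add_sg_mul]
    refine Finset.sum_le_sum fun ρ _ => mul_le_mul_of_nonneg_left (hW M hM ρ) ?_
    have : |s * sg (ρ o)| ≤ 1 := by rw [abs_mul, abs_sg, mul_one]; exact hs
    linarith [neg_le_of_abs_le this]
  have hbsum : ∀ o, b 1 o + b (-1) o = 2 * c := by
    intro o
    rw [hb, hc]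
    dsimp only
    rw [← mul_add, ← Finset.sum_add_distrib, mul_left_comm 2, Finset.mul_sum _ _ (2 : ℝ)]
    congr 1
    exact Finset.sum_congr rfl fun ρ _ => by ring
  have hkey : ∀ S : Finset K, ∑ o ∈ S, (R o - c) ≤ 1 := by
    intro S
    rcases S.eq_empty_or_nonempty with rfl | hS
    · simp
    have hn : (0 : ℝ) < S.card := by exact_mod_cast hS.card_pos
    have hRle : ∀ o, R o ≤ b 1 o / 2 + (S.card : ℝ)⁻¹ * ((∑ o' ∈ S, b (-1) o') / 2 + 1) := by
      intro o
      rw [hR]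
      refine csSup_le (hN.image _) ?_
      rintro _ ⟨M, hM, rfl⟩
      have h1 := hble 1 (by simp) o M hM
      have h2 : ∑ o' ∈ S, (2 * (-1) * v M o' + Φ M) ≤ ∑ o' ∈ S, b (-1) o' :=
        Finset.sum_le_sum fun o' _ => hble (-1) (by simp) o' M hM
      have h3 : ∑ o' ∈ S, v M o' ≤ 1 :=
        (Finset.sum_le_univ_sum_of_nonneg (hv0 M hM)).trans (hv1 M hM)
      rw [Finset.sum_add_distrib, ← Finset.mul_sum, Finset.sum_const, nsmul_eq_mul] at h2
      have h4 : Φ M / 2 ≤ (S.card : ℝ)⁻¹ * ((∑ o' ∈ S, b (-1) o') / 2 + 1) := by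
        rw [le_inv_mul_iff₀ hn]
        linarith
      dsimp only
      linarith
    calc ∑ o ∈ S, (R o - c)
        ≤ ∑ o ∈ S, (b 1 o / 2 + (S.card : ℝ)⁻¹ * ((∑ o' ∈ S, b (-1) o') / 2 + 1)
            - (b 1 o + b (-1) o) / 2) :=
          Finset.sum_le_sum fun o _ => by linarith [hRle o, hbsum o]
      _ = 1 := by
          rw [Finset.sum_sub_distrib, Finset.sum_add_distrib, Finset.sum_const, nsmul_eq_mul,
            mul_inv_cancel_left₀ hn.ne', ← Finset.sum_div, ← Finset.sum_div,
            Finset.sum_add_distrib]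
          ring
  set D : ℝ := ∑ o, max (R o - c) 0 with hD
  have hD1 : D ≤ 1 := by
    have : D = ∑ o ∈ Finset.univ.filter (fun o => 0 ≤ R o - c), (R o - c) := by
      rw [Finset.sum_filter]
      refine Finset.sum_congr rfl fun o _ => ?_
      split_ifs with h
      · exact max_eq_left h
      · exact max_eq_right (not_le.mp h).le
    rw [this]
    exact hkey _
  have hK : (0 : ℝ) < Fintype.card K := by exact_mod_cast Fintype.card_pos
  have hpad : 0 ≤ (1 - D) / Fintype.card K := div_nonneg (by linarith) hK.le
  refine ⟨fun o => max (R o - c) 0 + (1 - D) / Fintype.card K,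
    fun k => add_nonneg (le_max_right _ _) hpad, ?_, ?_⟩
  · rw [Finset.sum_add_distrib, ← hD, Finset.sum_const, nsmul_eq_mul, Finset.card_univ,
      mul_div_cancel₀ _ hK.ne']
    ring
  · intro o
    have := le_max_left (R o - c) 0
    dsimp only
    linarith

/-- Replace the signs of row `t` of `σ` by `ρ`. -/
def setRow {V κ : ℕ} (t : Fin V) (σ : Fin V × Fin κ → Bool) (ρ : Fin κ → Bool) :
    Fin V × Fin κ → Bool :=
  fun p => if p.1 = t then ρ p.2 else σ p

lemma sum_sum_setRow {V κ : ℕ} (t : Fin V) (F : (Fin V × Fin κ → Bool) → ℝ) :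
    ∑ σ, ((2 : ℝ) ^ κ)⁻¹ * ∑ ρ, F (setRow t σ ρ) = ∑ σ, F σ := by
  have hinv : Function.Involutive
      (fun p : (Fin V × Fin κ → Bool) × (Fin κ → Bool) =>
        ((setRow t p.1 p.2, fun k => p.1 (t, k)) :
          (Fin V × Fin κ → Bool) × (Fin κ → Bool))) := by
    rintro ⟨σ, ρ⟩
    ext p
    · obtain ⟨j, k⟩ := p
      by_cases h : j = t <;> simp [setRow, h]
    · simp [setRow]
  have h := Equiv.sum_comp hinv.toPerm (fun p => F p.1)
  simp only [Function.Involutive.coe_toPerm] at h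
  rw [Fintype.sum_prod_type, Fintype.sum_prod_type] at h
  simp only [Finset.sum_const, Finset.card_univ, nsmul_eq_mul, Fintype.card_fun,
    Fintype.card_bool, Fintype.card_fin, ← Finset.mul_sum] at h
  rw [← Finset.mul_sum, h]
  push_cast
  rw [inv_mul_cancel_left₀ (by positivity)]

/-- The objective of the Rademacher relaxation: rows before `t` carry the labels `y`,
the others carry random signs. -/
def relaxObj (V κ : ℕ) (t : ℕ) (y : Fin V → Fin κ) (σ : Fin V × Fin κ → Bool)
    (M : Fin V → Fin κ → ℝ) : ℝ :=
  2 * ∑ j : Fin V, ∑ k : Fin κ, (if t ≤ (j : ℕ) then sg (σ (j, k)) * M j k else 0)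
    + ∑ j : Fin V, if (j : ℕ) < t then M j (y j) else 0

lemma bddAbove_relaxObj (V κ : ℕ) (N : Set (Fin V → Fin κ → ℝ))
    (h01 : ∀ M ∈ N, ∀ t k, M t k ∈ Set.Icc (0 : ℝ) 1)
    (t : ℕ) (y : Fin V → Fin κ) (σ : Fin V × Fin κ → Bool) :
    BddAbove (relaxObj V κ t y σ '' N) := by
  refine ⟨2 * ∑ _j : Fin V, ∑ _k : Fin κ, 1 + ∑ _j : Fin V, 1, ?_⟩
  rintro _ ⟨M, hM, rfl⟩
  unfold relaxObj
  gcongr with j _ k _ j _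
  · obtain ⟨h0, h1⟩ := h01 M hM j k
    split_ifs
    · cases σ (j, k) <;> simp [sg] <;> linarith
    · exact zero_le_one
  · split_ifs
    · exact (h01 M hM j _).2
    · exact zero_le_one

/-- The value of the Rademacher relaxation for fixed signs. -/
noncomputable def relaxVal (V κ : ℕ) (N : Set (Fin V → Fin κ → ℝ)) (t : ℕ)
    (y : Fin V → Fin κ) (σ : Fin V × Fin κ → Bool) : ℝ :=
  sSup (relaxObj V κ t y σ '' N)

lemma sum_castLE_eq {V κ : ℕ} (t : Fin V) (y : Fin V → Fin κ) (M : Fin V → Fin κ → ℝ) :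
    ∑ s : Fin (t : ℕ), M (Fin.castLE t.isLt.le s) (y (Fin.castLE t.isLt.le s))
      = ∑ j : Fin V, if (j : ℕ) < (t : ℕ) then M j (y j) else 0 := by
  rw [← Finset.sum_filter]
  refine Finset.sum_bij (fun s _ => Fin.castLE t.isLt.le s) ?_ ?_ ?_ ?_
  · intro s _
    exact Finset.mem_filter.mpr ⟨Finset.mem_univ _, s.isLt⟩
  · intro a _ b _ h
    exact Fin.castLE_injective _ h
  · intro j hj
    exact ⟨⟨j, (Finset.mem_filter.mp hj).2⟩, Finset.mem_univ _, rfl⟩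
  · intro s _
    rfl

lemma sum_ite_lt_succ {V : ℕ} (t : Fin V) (g : Fin V → ℝ) :
    ∑ j : Fin V, (if (j : ℕ) < (t : ℕ) + 1 then g j else 0)
      = g t + ∑ j : Fin V, if (j : ℕ) < (t : ℕ) then g j else 0 := by
  have h : g t = ∑ j : Fin V, if j = t then g j else 0 := by simp
  rw [h, ← Finset.sum_add_distrib]
  refine Finset.sum_congr rfl fun j _ => ?_
  simp only [Fin.ext_iff]
  split_ifs <;> first | omega | simp

lemma sum_ite_le_eq {V : ℕ} (t : Fin V) (g : Fin V → ℝ) :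
    ∑ j : Fin V, (if (t : ℕ) ≤ (j : ℕ) then g j else 0)
      = g t + ∑ j : Fin V, if (t : ℕ) + 1 ≤ (j : ℕ) then g j else 0 := by
  have h : g t = ∑ j : Fin V, if j = t then g j else 0 := by simp
  rw [h, ← Finset.sum_add_distrib]
  refine Finset.sum_congr rfl fun j _ => ?_
  simp only [Fin.ext_iff]
  split_ifs <;> first | omega | simp

lemma sum_ite_const {κ : ℕ} (p : Prop) [Decidable p] (g : Fin κ → ℝ) :
    ∑ k, (if p then g k else 0) = if p then ∑ k, g k else 0 := by
  split_ifs <;> simp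

lemma Robj_eq_relaxVal (V κ : ℕ) (N : Set (Fin V → Fin κ → ℝ)) (t : Fin V)
    (y : Fin V → Fin κ) (σ : Fin V × Fin κ → Bool) :
    Robj V κ N (t : ℕ) t.isLt (fun s => y (Fin.castLE t.isLt.le s)) σ (y t)
      = relaxVal V κ N ((t : ℕ) + 1) y σ := by
  unfold Robj relaxVal
  congr 2
  funext M
  rw [relaxObj, sum_ite_lt_succ t fun j => M j (y j), sum_castLE_eq, ← add_assoc]

lemma relaxObj_setRow {V κ : ℕ} (t : Fin V) (y : Fin V → Fin κ)
    (σ : Fin V × Fin κ → Bool) (ρ : Fin κ → Bool) (M : Fin V → Fin κ → ℝ) :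
    relaxObj V κ (t : ℕ) y (setRow t σ ρ) M
      = 2 * ∑ k, sg (ρ k) * M t k
        + (2 * ∑ j : Fin V, ∑ k : Fin κ,
            (if (t : ℕ) + 1 ≤ (j : ℕ) then sg (σ (j, k)) * M j k else 0)
          + ∑ s : Fin (t : ℕ), M (Fin.castLE t.isLt.le s) (y (Fin.castLE t.isLt.le s))) := by
  rw [relaxObj, sum_castLE_eq]
  simp_rw [sum_ite_const]
  rw [sum_ite_le_eq t]
  have h : ∀ j : Fin V,
      (if (t : ℕ) + 1 ≤ (j : ℕ) then ∑ k, sg (setRow t σ ρ (j, k)) * M j k else 0)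
        = if (t : ℕ) + 1 ≤ (j : ℕ) then ∑ k, sg (σ (j, k)) * M j k else 0 := by
    intro j
    split_ifs with hj
    · have hne : j ≠ t := by rintro rfl; omega
      simp [setRow, hne]
    · rfl
  simp_rw [h]
  simp only [setRow, if_true]
  ring

/-- Regret of the forecaster against a fixed instance and label sequence, averaged over signs. -/
lemma pathwise_regret_le (V κ : ℕ) (hκ : 0 < κ) (N : Set (Fin V → Fin κ → ℝ))
    (hN : N.Nonempty) (h01 : ∀ M ∈ N, ∀ t k, M t k ∈ Set.Icc (0 : ℝ) 1)
    (hrow : ∀ M ∈ N, ∀ t, ∑ k, M t k ≤ 1)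
    (G : Finset (Fin V → Fin κ)) (hG : G.Nonempty)
    (hGM : ∀ f ∈ G, (fun t k => if f t = k then (1 : ℝ) else 0) ∈ N)
    (y : Fin V → Fin κ)
    (q : (t : Fin V) → (Fin V × Fin κ → Bool) → Fin κ → ℝ)
    (hqmin : ∀ (t : Fin V) (σ : Fin V × Fin κ → Bool) (p : Fin κ → ℝ),
      (∀ k, 0 ≤ p k) → (∑ k, p k = 1) →
      Finset.univ.sup' ⟨⟨0, hκ⟩, Finset.mem_univ _⟩
          (fun o => 1 - q t σ o
            + Robj V κ N (t : ℕ) t.isLt (fun s => y (Fin.castLE t.isLt.le s)) σ o)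
        ≤ Finset.univ.sup' ⟨⟨0, hκ⟩, Finset.mem_univ _⟩
          (fun o => 1 - p o
            + Robj V κ N (t : ℕ) t.isLt (fun s => y (Fin.castLE t.isLt.le s)) σ o)) :
    (∑ t : Fin V, ((2 : ℝ) ^ (V * κ))⁻¹ * ∑ σ : Fin V × Fin κ → Bool, (1 - q t σ (y t)))
      - G.inf' hG (fun f => ∑ t : Fin V, if f t ≠ y t then (1 : ℝ) else 0)
      ≤ 2 * radSet V κ N := by
  have : Nonempty (Fin κ) := ⟨⟨0, hκ⟩⟩
  set P : ℝ := ((2 : ℝ) ^ (V * κ))⁻¹ with hP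
  have hPpos : 0 < P := by positivity
  have hcard : P * ∑ _σ : Fin V × Fin κ → Bool, (1 : ℝ) = 1 := by
    simp [hP]
  set A : ℕ → ℝ := fun t => P * ∑ σ, relaxVal V κ N t y σ with hA
  have hstep : ∀ t : Fin V,
      P * ∑ σ : Fin V × Fin κ → Bool, (1 - q t σ (y t)) ≤ 1 + (A t - A (t + 1)) := by
    intro t
    have hσ : ∀ σ : Fin V × Fin κ → Bool, 1 - q t σ (y t) + relaxVal V κ N ((t : ℕ) + 1) y σ
        ≤ 1 + ((2 : ℝ) ^ κ)⁻¹ * ∑ ρ, relaxVal V κ N t y (setRow t σ ρ) := by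
      intro σ
      obtain ⟨p, hp0, hp1, hp⟩ := exists_prob_le N hN (fun M => M t)
        (fun M => 2 * ∑ j : Fin V, ∑ k : Fin κ,
            (if (t : ℕ) + 1 ≤ (j : ℕ) then sg (σ (j, k)) * M j k else 0)
          + ∑ s : Fin (t : ℕ), M (Fin.castLE t.isLt.le s) (y (Fin.castLE t.isLt.le s)))
        (fun M hM k => (h01 M hM t k).1) (fun M hM => hrow M hM t)
        (fun ρ => relaxVal V κ N t y (setRow t σ ρ))
        (fun M hM ρ => by
          rw [← relaxObj_setRow]
          exact le_csSup (bddAbove_relaxObj V κ N h01 _ _ _) ⟨M, hM, rfl⟩)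
        (fun o => Robj V κ N (t : ℕ) t.isLt (fun s => y (Fin.castLE t.isLt.le s)) σ o)
        (fun o => by
          unfold Robj
          congr 2
          funext M
          simp only [Fin.eta]
          ring)
      rw [Fintype.card_fin] at hp
      rw [← Robj_eq_relaxVal]
      refine (Finset.le_sup' (fun o => 1 - q t σ o
            + Robj V κ N (t : ℕ) t.isLt (fun s => y (Fin.castLE t.isLt.le s)) σ o)
          (Finset.mem_univ (y t))).trans ((hqmin t σ p hp0 hp1).trans ?_)
      exact Finset.sup'_le _ _ fun o _ => hp o
    have hsum := mul_le_mul_of_nonneg_left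
      (Finset.sum_le_sum fun σ (_ : σ ∈ Finset.univ) => hσ σ) hPpos.le
    rw [Finset.sum_add_distrib, Finset.sum_add_distrib, sum_sum_setRow, mul_add, mul_add,
      hcard] at hsum
    simp only [hA]
    linarith
  have hsteps : ∑ t : Fin V, P * ∑ σ : Fin V × Fin κ → Bool, (1 - q t σ (y t))
      ≤ V + (A 0 - A V) := by
    refine (Finset.sum_le_sum fun t _ => hstep t).trans_eq ?_
    rw [Finset.sum_add_distrib, Fin.sum_univ_eq_sum_range (fun t => A t - A (t + 1)),
      Finset.sum_range_sub']
    simp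
  have hA0 : A 0 ≤ 2 * radSet V κ N := by
    rw [hA, radSet, mul_left_comm, Finset.mul_sum]
    refine mul_le_mul_of_nonneg_left (Finset.sum_le_sum fun σ _ => ?_) hPpos.le
    have hobj : ∀ M, relaxObj V κ 0 y σ M
        = 2 * ∑ t : Fin V, ∑ k : Fin κ, sg (σ (t, k)) * M t k := by
      intro M
      simp [relaxObj]
    refine csSup_le (hN.image _) ?_
    rintro _ ⟨M, hM, rfl⟩
    rw [hobj]
    refine mul_le_mul_of_nonneg_left (le_csSup ?_ ⟨M, hM, rfl⟩) zero_le_two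
    obtain ⟨B, hB⟩ := bddAbove_relaxObj V κ N h01 0 y σ
    refine ⟨B / 2, ?_⟩
    rintro _ ⟨M', hM', rfl⟩
    have := hB ⟨M', hM', rfl⟩
    rw [hobj] at this
    dsimp only
    linarith
  have hAV : V - G.inf' hG (fun f => ∑ t : Fin V, if f t ≠ y t then (1 : ℝ) else 0) ≤ A V := by
    obtain ⟨f, hf, hfe⟩ := Finset.exists_mem_eq_inf' hG
      (fun f => ∑ t : Fin V, if f t ≠ y t then (1 : ℝ) else 0)
    rw [hfe]
    set L : ℝ := V - ∑ t : Fin V, if f t ≠ y t then (1 : ℝ) else 0 with hL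
    have hval : ∀ σ, L ≤ relaxVal V κ N V y σ := by
      intro σ
      refine le_csSup_of_le (bddAbove_relaxObj V κ N h01 _ _ _) ⟨_, hGM f hf, rfl⟩ ?_
      have hlt : ∀ j : Fin V, ¬ V ≤ (j : ℕ) := fun j => not_le.mpr j.isLt
      have hV : (V : ℝ) = ∑ _t : Fin V, 1 := by simp
      simp only [relaxObj, hlt, Fin.is_lt, if_false, if_true, Finset.sum_const_zero, mul_zero,
        zero_add]
      rw [hL, hV, ← Finset.sum_sub_distrib]
      refine Finset.sum_le_sum fun j _ => ?_
      by_cases h : f j = y j <;> simp [h]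
    calc L = P * ∑ _σ : Fin V × Fin κ → Bool, L * 1 := by
          rw [← Finset.mul_sum, mul_left_comm, hcard, mul_one]
      _ ≤ A V := mul_le_mul_of_nonneg_left (Finset.sum_le_sum fun σ _ => (mul_one L).trans_le (hval σ))
          hPpos.le
  linarith

/-- the random-playout forecaster based on the Rademacher
relaxation over the relaxed matrix sets `𝓜(ι) ⊇ {M_f : f ∈ G(ι)}` has expected
regret at most `2 E_{ι∼μ} Rad(𝓜(ι))` against every deterministic adaptive
adversary.  Rounds are 0-indexed: at round `t : Fin V` the instance prefix has
length `t + 1` and the past-label prefix has length `t`; the playout `ι'`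
ranges over full sequences agreeing with `ι` on the first `t + 1` coordinates. -/
theorem stmt_4 (V κ : ℕ) (hV : 0 < V) (hκ : 0 < κ)
    (I : Type) [Fintype I] [DecidableEq I] [Nonempty I]
    (μ : (Fin V → I) → ℝ) (hμ0 : ∀ ι, 0 ≤ μ ι) (hμ1 : ∑ ι, μ ι = 1)
    (G : (Fin V → I) → Finset (Fin V → Fin κ)) (hG : ∀ ι, (G ι).Nonempty)
    (MM : (Fin V → I) → Set (Fin V → Fin κ → ℝ))
    (hMne : ∀ ι, (MM ι).Nonempty)
    (hM01 : ∀ ι, ∀ M ∈ MM ι, ∀ t k, M t k ∈ Set.Icc (0 : ℝ) 1)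
    (hMrow : ∀ ι, ∀ M ∈ MM ι, ∀ t, ∑ k, M t k ≤ 1)
    (hGM : ∀ ι, ∀ f ∈ G ι, (fun t k => if f t = k then (1 : ℝ) else 0) ∈ MM ι)
    -- deterministic adaptive adversary
    (Y : (t : ℕ) → (Fin t → I) → Fin κ)
    -- the forecaster: a probability vector for each round, combined sequence,
    -- past-label prefix and Rademacher draw …
    (qhat : (t : Fin V) → (Fin V → I) → (Fin (t : ℕ) → Fin κ) →
      (Fin V × Fin κ → Bool) → Fin κ → ℝ)
    (hqhat0 : ∀ t ι' ys σ k, 0 ≤ qhat t ι' ys σ k)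
    (hqhat1 : ∀ t ι' ys σ, ∑ k, qhat t ι' ys σ k = 1)
    -- … minimizing `q ↦ max_o [1 − q(o) + R_t(o)]`
    (hqmin : ∀ (t : Fin V) (ι' : Fin V → I) (ys : Fin (t : ℕ) → Fin κ)
      (σ : Fin V × Fin κ → Bool) (q : Fin κ → ℝ),
      (∀ k, 0 ≤ q k) → (∑ k, q k = 1) →
      Finset.univ.sup' ⟨⟨0, hκ⟩, Finset.mem_univ _⟩
          (fun o => 1 - qhat t ι' ys σ o + Robj V κ (MM ι') (t : ℕ) t.isLt ys σ o)
        ≤ Finset.univ.sup' ⟨⟨0, hκ⟩, Finset.mem_univ _⟩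
          (fun o => 1 - q o + Robj V κ (MM ι') (t : ℕ) t.isLt ys σ o)) :
    -- expected regret bound
    ∑ ι, μ ι *
        ((∑ t : Fin V, condExp V μ ((t : ℕ) + 1) ι (fun ι' =>
            ((2 : ℝ) ^ (V * κ))⁻¹ * ∑ σ : Fin V × Fin κ → Bool,
              (1 - qhat t ι'
                (fun s : Fin (t : ℕ) => Y ((s : ℕ) + 1)
                  (fun i => ι (Fin.castLE (Nat.succ_le_of_lt (lt_trans s.isLt t.isLt)) i)))
                σ
                (Y ((t : ℕ) + 1) (fun i => ι (Fin.castLE t.isLt i))))))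
          - (G ι).inf' (hG ι) (fun f => ∑ t : Fin V,
              if f t ≠ Y ((t : ℕ) + 1) (fun i => ι (Fin.castLE t.isLt i)) then (1 : ℝ) else 0))
      ≤ 2 * ∑ ι, μ ι * radSet V κ (MM ι) := by
  set y : (Fin V → I) → Fin V → Fin κ :=
    fun ι t => Y ((t : ℕ) + 1) (fun i => ι (Fin.castLE t.isLt i)) with hy
  have hplayout : ∀ t : Fin V,
      ∑ ι, μ ι * condExp V μ ((t : ℕ) + 1) ι (fun ι' =>
          ((2 : ℝ) ^ (V * κ))⁻¹ * ∑ σ : Fin V × Fin κ → Bool,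
            (1 - qhat t ι' (fun s => y ι (Fin.castLE t.isLt.le s)) σ (y ι t)))
        = ∑ ι, μ ι * (((2 : ℝ) ^ (V * κ))⁻¹ * ∑ σ : Fin V × Fin κ → Bool,
            (1 - qhat t ι (fun s => y ι (Fin.castLE t.isLt.le s)) σ (y ι t))) := by
    intro t
    refine sum_mul_condExp V μ hμ0 ((t : ℕ) + 1)
      (fun ι ι' => ((2 : ℝ) ^ (V * κ))⁻¹ * ∑ σ : Fin V × Fin κ → Bool,
        (1 - qhat t ι' (fun s => y ι (Fin.castLE t.isLt.le s)) σ (y ι t))) ?_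
    intro ι ι' h
    have hlab : ∀ s : Fin V, (s : ℕ) ≤ t → y ι s = y ι' s := by
      intro s hs
      simp only [hy]
      congr 1
      funext i
      refine (h _ ?_).symm
      have := i.isLt
      simp only [Fin.val_castLE]
      omega
    have hpast : (fun s : Fin (t : ℕ) => y ι (Fin.castLE t.isLt.le s))
        = fun s => y ι' (Fin.castLE t.isLt.le s) :=
      funext fun s => hlab _ s.isLt.le
    rw [hpast, hlab t le_rfl]
  have hpath : ∀ ι, μ ι * ((∑ t : Fin V, ((2 : ℝ) ^ (V * κ))⁻¹ *
        ∑ σ : Fin V × Fin κ → Bool,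
          (1 - qhat t ι (fun s => y ι (Fin.castLE t.isLt.le s)) σ (y ι t)))
      - (G ι).inf' (hG ι) (fun f => ∑ t : Fin V, if f t ≠ y ι t then (1 : ℝ) else 0))
      ≤ μ ι * (2 * radSet V κ (MM ι)) := fun ι =>
    mul_le_mul_of_nonneg_left
      (pathwise_regret_le V κ hκ (MM ι) (hMne ι) (hM01 ι) (hMrow ι) (G ι) (hG ι) (hGM ι) (y ι)
        (fun t σ => qhat t ι (fun s => y ι (Fin.castLE t.isLt.le s)) σ)
        (fun t σ p => hqmin t ι _ σ p)) (hμ0 ι)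
  have hswap : ∀ (a : (Fin V → I) → Fin V → ℝ) (c : (Fin V → I) → ℝ),
      ∑ ι, μ ι * ((∑ t, a ι t) - c ι) = (∑ t, ∑ ι, μ ι * a ι t) - ∑ ι, μ ι * c ι := by
    intro a c
    rw [Finset.sum_comm, ← Finset.sum_sub_distrib]
    exact Finset.sum_congr rfl fun ι _ => by rw [mul_sub, Finset.mul_sum]
  calc _ = ∑ ι, μ ι * ((∑ t : Fin V, condExp V μ ((t : ℕ) + 1) ι (fun ι' =>
            ((2 : ℝ) ^ (V * κ))⁻¹ * ∑ σ : Fin V × Fin κ → Bool,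
              (1 - qhat t ι' (fun s => y ι (Fin.castLE t.isLt.le s)) σ (y ι t))))
          - (G ι).inf' (hG ι) (fun f => ∑ t : Fin V, if f t ≠ y ι t then (1 : ℝ) else 0)) := rfl
    _ = ∑ ι, μ ι * ((∑ t : Fin V, ((2 : ℝ) ^ (V * κ))⁻¹ *
            ∑ σ : Fin V × Fin κ → Bool,
              (1 - qhat t ι (fun s => y ι (Fin.castLE t.isLt.le s)) σ (y ι t)))
          - (G ι).inf' (hG ι) (fun f => ∑ t : Fin V, if f t ≠ y ι t then (1 : ℝ) else 0)) := by
        rw [hswap, hswap, Finset.sum_congr rfl fun t _ => hplayout t]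
    _ ≤ ∑ ι, μ ι * (2 * radSet V κ (MM ι)) := Finset.sum_le_sum fun ι _ => hpath ι
    _ = 2 * ∑ ι, μ ι * radSet V κ (MM ι) := by
        rw [Finset.mul_sum]
        exact Finset.sum_congr rfl fun ι _ => by ring

end Stmt4
end

section
/- Let n ≥ 1, let S ⊆ ℝ^n be nonempty and compact, G : S → [0,∞) continuous, T ⊆ ℝ^n nonempty and finite, g : T → [0,∞), Y ∈ ℝ^n, K ≥ 0 and γ > 0. Assume {u ∈ S : G(u) ≤ K} is nonempty, and that for every D ∈ ℝ one has min{ g(m) : m ∈ T, ⟨Y,m⟩ ≥ D } ≤ γ · inf{ G(u) : u ∈ S, ⟨Y,u⟩ ≥ D }, where the minimum/infimum over an empty set is interpreted as +∞. Then the set {m ∈ T : g(m) ≤ γK} is nonempty and max{ ⟨Y,u⟩ : u ∈ S, G(u) ≤ K } ≤ max{ ⟨Y,m⟩ : m ∈ T, g(m) ≤ γK }. -/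
/-- transferring the value of the constrained relaxation at budget
`K` to the integral optimum at the enlarged budget `γK`, assuming the
integrality gap of the second-form programs is at most `γ`.  Infima of the
second-form programs are taken in `EReal` so that the infimum over an empty
feasible set is `⊤ = +∞`. -/
theorem stmt_5 (n : ℕ) (hn : 1 ≤ n)
    (S : Set (Fin n → ℝ)) (hSne : S.Nonempty) (hSc : IsCompact S)
    (G : (Fin n → ℝ) → ℝ) (hGc : ContinuousOn G S) (hG0 : ∀ u ∈ S, 0 ≤ G u)
    (T : Finset (Fin n → ℝ)) (hT : T.Nonempty)
    (g : (Fin n → ℝ) → ℝ) (hg0 : ∀ m ∈ T, 0 ≤ g m)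
    (Y : Fin n → ℝ) (K : ℝ) (hK : 0 ≤ K) (γ : ℝ) (hγ : 0 < γ)
    (hfeas : {u ∈ S | G u ≤ K}.Nonempty)
    (hgap : ∀ D : ℝ,
      sInf ((fun m => (g m : EReal)) '' {m | m ∈ T ∧ D ≤ ∑ i, Y i * m i})
        ≤ (γ : EReal) * sInf ((fun u => (G u : EReal)) '' {u ∈ S | D ≤ ∑ i, Y i * u i})) :
    {m | m ∈ T ∧ g m ≤ γ * K}.Nonempty ∧
      sSup ((fun u => ∑ i, Y i * u i) '' {u ∈ S | G u ≤ K})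
        ≤ sSup ((fun m => ∑ i, Y i * m i) '' {m | m ∈ T ∧ g m ≤ γ * K}) := by
  have key : ∀ u ∈ S, G u ≤ K →
      ∃ m, (m ∈ T ∧ g m ≤ γ * K) ∧ ∑ i, Y i * u i ≤ ∑ i, Y i * m i := by
    intro u hu hGu
    have hle : sInf ((fun m => (g m : EReal)) '' {m | m ∈ T ∧ ∑ i, Y i * u i ≤ ∑ i, Y i * m i})
        ≤ ((γ * K : ℝ) : EReal) := by
      refine (hgap _).trans ?_
      rw [EReal.coe_mul]
      refine mul_le_mul_of_nonneg_left ?_ (EReal.coe_nonneg.mpr hγ.le)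
      exact sInf_le_of_le ⟨u, ⟨hu, le_rfl⟩, rfl⟩ (EReal.coe_le_coe_iff.mpr hGu)
    have hfin : ((fun m => (g m : EReal)) ''
        {m | m ∈ T ∧ ∑ i, Y i * u i ≤ ∑ i, Y i * m i}).Finite :=
      (T.finite_toSet.subset fun m hm => hm.1).image _
    have hne : ((fun m => (g m : EReal)) ''
        {m | m ∈ T ∧ ∑ i, Y i * u i ≤ ∑ i, Y i * m i}).Nonempty := by
      rw [Set.nonempty_iff_ne_empty]
      intro h
      rw [h, sInf_empty] at hle
      exact absurd hle (not_le.mpr (EReal.coe_lt_top _))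
    obtain ⟨m, hm, hgm⟩ := hne.csInf_mem hfin
    refine ⟨m, ⟨hm.1, EReal.coe_le_coe_iff.mp ?_⟩, hm.2⟩
    exact hgm.le.trans hle
  have hbdd : BddAbove ((fun m => ∑ i, Y i * m i) '' {m | m ∈ T ∧ g m ≤ γ * K}) :=
    ((T.finite_toSet.subset fun m hm => hm.1).image _).bddAbove
  refine ⟨?_, csSup_le (hfeas.image _) ?_⟩
  · obtain ⟨u, hu, hGu⟩ := hfeas
    obtain ⟨m, hm, -⟩ := key u hu hGu
    exact ⟨m, hm⟩
  · rintro _ ⟨u, ⟨hu, hGu⟩, rfl⟩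
    obtain ⟨m, hm, hum⟩ := key u hu hGu
    exact hum.trans (le_csSup hbdd ⟨m, hm, rfl⟩)
end

section
/- Let I be a nonempty finite set, μ a probability distribution on I^V, and K ≥ 0. For each ι ∈ I^V suppose given: a nonempty finite set L(ι) of assignment matrices with cost g_ι : L(ι) → [0,∞) such that F_K(ι) := {m ∈ L(ι) : g_ι(m) ≤ K} is nonempty; a nonempty compact subset S(ι) ⊆ ℝ^{n_ι} (for some dimension n_ι); a continuous map Φ_ι : S(ι) → [0,1]^{V×κ} whose values have row sums at most 1; and a continuous cost G_ι : S(ι) → [0,∞), such that for every m ∈ L(ι) there exists u ∈ S(ι) with Φ_ι(u) = m and G_ι(u) ≤ g_ι(m). Suppose γ(ι) ≥ 1 satisfies the integrality-gap condition: for every ε ∈ {−1,1}^{V×κ} and every D ∈ ℝ, min{ g_ι(m) : m ∈ L(ι), ⟨ε,m⟩ ≥ D } ≤ γ(ι) · inf{ G_ι(u) : u ∈ S(ι), ⟨ε,Φ_ι(u)⟩ ≥ D } (empty minimum/infimum = +∞), where ⟨ε,M⟩ := Σ_{t,k} ε_{t,k}M_{t,k}. Take as comparator class G(ι) := { label sequences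 f : M_f ∈ L(ι) and g_ι(M_f) ≤ K }, and run the random-playout forecaster with relaxed matrix set 𝓜(ι) := { Φ_ι(u) : u ∈ S(ι), G_ι(u) ≤ K }: at round t it draws ι' ∼ μ(·|ι_{1:t}) and uniform ε ∈ {−1,1}^{(V−t)×κ}, computes R_t(o) = sup_{M∈𝓜((ι_{1:t},ι'))}[ 2 Σ_{j=t+1}^V Σ_k ε_{j,k}M_{j,k} + M_{t,o} + Σ_{s=1}^{t−1} M_{s,y_s} ] for each o ∈ [κ], and plays a probability vector minimizing q ↦ max_o [1 − q(o) + R_t(o)]. Then for every deterministic adaptive adversary Y_t : I^t → [κ], the expected regret with respect to G(ι) is at most 2 · E_{ι∼μ} Rad( {m ∈ L(ι) : g_ι(m) ≤ γ(ι)·K} ). -/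
namespace Stmt6

/-- Rademacher sign of a Boolean. -/
def sg (b : Bool) : ℝ := if b then 1 else -1

/-- The assignment matrix of a label sequence. -/
def Mf {V κ : ℕ} (f : Fin V → Fin κ) : Fin V → Fin κ → ℝ :=
  fun t k => if f t = k then 1 else 0

/-- Conditional expectation, under the distribution `μ` on instance sequences,
of `f` given that the first `t` coordinates of the sequence equal those of `ι`
(by Lean's convention `x/0 = 0` it takes the junk value `0` on prefixes of zero
probability, which do not contribute to any expectation below). -/
noncomputable def condExp {I : Type} [Fintype I] [DecidableEq I] (V : ℕ)
    (μ : (Fin V → I) → ℝ) (t : ℕ) (ι : Fin V → I) (f : (Fin V → I) → ℝ) : ℝ :=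
  (∑ ι' : Fin V → I, if ∀ j : Fin V, (j : ℕ) < t → ι' j = ι j then μ ι' * f ι' else 0) /
    (∑ ι' : Fin V → I, if ∀ j : Fin V, (j : ℕ) < t → ι' j = ι j then μ ι' else 0)

/-- The Rademacher complexity `Rad(N)` of a set `N` of real `V × κ` matrices. -/
noncomputable def radSet (V κ : ℕ) (N : Set (Fin V → Fin κ → ℝ)) : ℝ :=
  ((2 : ℝ) ^ (V * κ))⁻¹ * ∑ σ : Fin V × Fin κ → Bool,
    sSup ((fun M => ∑ t : Fin V, ∑ k : Fin κ, sg (σ (t, k)) * M t k) '' N)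

/-- The inner product `⟨ε, M⟩ = Σ_{t,k} ε_{t,k} M_{t,k}` of a sign pattern with
a matrix. -/
def inn {V κ : ℕ} (σ : Fin V × Fin κ → Bool) (M : Fin V → Fin κ → ℝ) : ℝ :=
  ∑ t : Fin V, ∑ k : Fin κ, sg (σ (t, k)) * M t k

/-- The quantity `R_t(o)` at 0-indexed round `t` (past labels `ys` of length
`t`), relaxed over a set `N` of matrices. -/
noncomputable def Robj (V κ : ℕ) (N : Set (Fin V → Fin κ → ℝ))
    (t : ℕ) (ht : t < V) (ys : Fin t → Fin κ)
    (σ : Fin V × Fin κ → Bool) (o : Fin κ) : ℝ :=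
  sSup ((fun M => 2 * ∑ j : Fin V, ∑ k : Fin κ,
        (if t + 1 ≤ (j : ℕ) then sg (σ (j, k)) * M j k else 0)
      + M ⟨t, ht⟩ o + ∑ s : Fin t, M (Fin.castLE ht.le s) (ys s)) '' N)

section Averaging

variable {α : Type*}

/-- Flip the signs of the coordinates marked by `b`. -/
def flipSigns (b : α → Bool) : (α → Bool) ≃ (α → Bool) :=
  Function.Involutive.toPerm (fun τ p => xor (τ p) (b p)) (fun τ => by ext p; simp)

lemma flipSigns_apply (b τ : α → Bool) (p : α) : flipSigns b τ p = xor (τ p) (b p) := rfl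

lemma sg_not (b : Bool) : sg (!b) = -sg b := by cases b <;> simp [sg]

/-- Resampling the coordinates in `p` does not change a uniform average. -/
lemma sum_sum_piecewise [Fintype α] [DecidableEq α] (p : α → Prop) [DecidablePred p]
    (H : (α → Bool) → ℝ) :
    ∑ σ : α → Bool, ∑ τ : α → Bool, H (fun a => if p a then τ a else σ a)
      = 2 ^ Fintype.card α * ∑ σ, H σ := by
  let e : Equiv.Perm ((α → Bool) × (α → Bool)) :=
    Function.Involutive.toPerm
      (fun x => (fun a => if p a then x.2 a else x.1 a, fun a => if p a then x.1 a else x.2 a))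
      (fun x => by ext a <;> by_cases h : p a <;> simp [h])
  have h := Equiv.sum_comp e (fun x => H x.1)
  rw [Fintype.sum_prod_type, Fintype.sum_prod_type] at h
  refine h.trans ?_
  simp [Finset.mul_sum]

end Averaging

section OneRound

variable {X : Type*} {N : Set X} {κ : ℕ}

lemma bddAbove_image_add_sum {r : X → ℝ} {m : X → Fin κ → ℝ} {C : ℝ}
    (hr : ∀ x ∈ N, r x ≤ C) (hm : ∀ x ∈ N, ∀ k, m x k ∈ Set.Icc (0 : ℝ) 1) (c : Fin κ → ℝ) :
    BddAbove ((fun x => r x + ∑ k, c k * m x k) '' N) := by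
  refine ⟨C + ∑ k, |c k|, ?_⟩
  rintro _ ⟨x, hx, rfl⟩
  refine add_le_add (hr x hx) (Finset.sum_le_sum fun k _ => ?_)
  have h := hm x hx k
  calc c k * m x k ≤ |c k| * m x k := mul_le_mul_of_nonneg_right (le_abs_self _) h.1
    _ ≤ |c k| * 1 := mul_le_mul_of_nonneg_left h.2 (abs_nonneg _)
    _ = |c k| := mul_one _

/-- Jensen's inequality for a single coordinate of a Rademacher process. -/
lemma sSup_add_sSup_le_average {α : Type*} [Fintype α] [DecidableEq α] (hN : N.Nonempty)
    {r : X → ℝ} {m : X → Fin κ → ℝ} {C : ℝ}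
    (hr : ∀ x ∈ N, r x ≤ C) (hm : ∀ x ∈ N, ∀ k, m x k ∈ Set.Icc (0 : ℝ) 1)
    (e : Fin κ → α) (he : Function.Injective e) (o : Fin κ) :
    sSup ((fun x => r x + 2 * m x o) '' N) + sSup ((fun x => r x - 2 * m x o) '' N) ≤
      2 * (((2 : ℝ) ^ Fintype.card α)⁻¹ * ∑ τ : α → Bool,
        sSup ((fun x => r x + ∑ k, (2 * sg (τ (e k))) * m x k) '' N)) := by
  set H : (α → Bool) → ℝ := fun τ =>
    sSup ((fun x => r x + ∑ k, (2 * sg (τ (e k))) * m x k) '' N)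
  let P : Bool → ℝ := fun b => sSup ((fun x => r x + 2 * sg b * m x o) '' N)
  let F := flipSigns (fun a => decide (a ≠ e o))
  let F' := flipSigns (fun a => decide (a = e o))
  have le_H : ∀ τ, ∀ x ∈ N, r x + ∑ k, (2 * sg (τ (e k))) * m x k ≤ H τ := fun τ x hx =>
    le_csSup (bddAbove_image_add_sum hr hm _) (Set.mem_image_of_mem _ hx)
  have key : ∀ τ, P (τ (e o)) ≤ (H τ + H (F τ)) / 2 := by
    intro τ
    refine csSup_le (hN.image _) ?_
    rintro _ ⟨x, hx, rfl⟩
    have h1 := le_H τ x hx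
    have h2 := le_H (F τ) x hx
    have h3 : ∑ k, (2 * sg (τ (e k))) * m x k + ∑ k, (2 * sg (F τ (e k))) * m x k
        = 4 * sg (τ (e o)) * m x o := by
      rw [← Finset.sum_add_distrib, Finset.sum_eq_single o]
      · simp only [F, flipSigns_apply, ne_eq, not_true_eq_false, decide_false, Bool.xor_false]
        ring
      · intro k _ hk
        simp only [F, flipSigns_apply, he.ne hk, ne_eq, not_false_eq_true, decide_true,
          Bool.xor_true, sg_not]
        ring
      · simp
    show r x + 2 * sg (τ (e o)) * m x o ≤ _
    linarith
  have hP : ∀ τ : α → Bool, P true + P false = P (τ (e o)) + P (F' τ (e o)) := by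
    intro τ
    simp only [F', flipSigns_apply, decide_true, Bool.xor_true]
    cases τ (e o) <;> simp [add_comm]
  have htot : ∑ τ : α → Bool, (P true + P false) ≤ 2 * ∑ τ, H τ := by
    calc ∑ τ : α → Bool, (P true + P false)
        ≤ ∑ τ, ((H τ + H (F τ)) / 2 + (H (F' τ) + H (F (F' τ))) / 2) :=
          Finset.sum_le_sum fun τ _ => by
            rw [hP τ]; exact add_le_add (key τ) (key (F' τ))
      _ = 2 * ∑ τ, H τ := by
          rw [Finset.sum_add_distrib, ← Finset.sum_div, ← Finset.sum_div,
            Finset.sum_add_distrib, Finset.sum_add_distrib, Equiv.sum_comp F H,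
            Equiv.sum_comp F' H, Equiv.sum_comp F' (fun τ => H (F τ)), Equiv.sum_comp F H]
          ring
  have hcard : ∑ τ : α → Bool, (P true + P false) = 2 ^ Fintype.card α * (P true + P false) := by
    rw [Finset.sum_const, nsmul_eq_mul]
    simp
  have hPQ : sSup ((fun x => r x + 2 * m x o) '' N) + sSup ((fun x => r x - 2 * m x o) '' N)
      = P true + P false := by
    simp [P, sg, sub_eq_add_neg]
  rw [hPQ]
  rw [hcard] at htot
  rw [← mul_assoc, mul_comm (2 : ℝ), mul_assoc, inv_mul_eq_div, le_div_iff₀ (by positivity)]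
  linarith

/-- Relaxation admissibility in summed form: symmetrization over any set `A` of labels. -/
lemma sum_sSup_le {B C : ℝ} (hN : N.Nonempty) {r : X → ℝ} {m : X → Fin κ → ℝ}
    (hr : ∀ x ∈ N, r x ≤ C) (hm : ∀ x ∈ N, ∀ k, m x k ∈ Set.Icc (0 : ℝ) 1)
    (hrow : ∀ x ∈ N, ∑ k, m x k ≤ 1)
    (hB : ∀ o, sSup ((fun x => r x + 2 * m x o) '' N) + sSup ((fun x => r x - 2 * m x o) '' N)
      ≤ 2 * B) (A : Finset (Fin κ)) :
    ∑ o ∈ A, sSup ((fun x => r x + m x o) '' N) ≤ 1 + A.card * B := by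
  rcases A.eq_empty_or_nonempty with rfl | hA
  · simp
  have hcard : (0 : ℝ) < A.card := by exact_mod_cast hA.card_pos
  set P : Fin κ → ℝ := fun o => sSup ((fun x => r x + 2 * m x o) '' N)
  set Q : Fin κ → ℝ := fun o => sSup ((fun x => r x - 2 * m x o) '' N)
  have le_P : ∀ o, ∀ x ∈ N, r x + 2 * m x o ≤ P o := fun o x hx =>
    le_csSup ⟨C + 2, by rintro _ ⟨z, hz, rfl⟩; linarith [hr z hz, (hm z hz o).2]⟩
      (Set.mem_image_of_mem _ hx)
  have le_Q : ∀ o, ∀ x ∈ N, r x - 2 * m x o ≤ Q o := fun o x hx =>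
    le_csSup ⟨C, by rintro _ ⟨z, hz, rfl⟩; linarith [hr z hz, (hm z hz o).1]⟩
      (Set.mem_image_of_mem _ hx)
  have h1 : ∀ o, sSup ((fun x => r x + m x o) '' N)
      ≤ (1 + ∑ o' ∈ A, (P o + Q o') / 2) / A.card := by
    intro o
    refine csSup_le (hN.image _) ?_
    rintro _ ⟨x, hx, rfl⟩
    rw [le_div_iff₀ hcard]
    have hs : ∑ o' ∈ A, m x o' ≤ 1 :=
      (Finset.sum_le_sum_of_subset_of_nonneg (Finset.subset_univ A)
        fun k _ _ => (hm x hx k).1).trans (hrow x hx)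
    have h2 : ∑ o' ∈ A, (r x + m x o - m x o') ≤ ∑ o' ∈ A, (P o + Q o') / 2 :=
      Finset.sum_le_sum fun o' _ => by linarith [le_P o x hx, le_Q o' x hx]
    rw [Finset.sum_sub_distrib, Finset.sum_const, nsmul_eq_mul] at h2
    show (r x + m x o) * _ ≤ _
    linarith
  calc ∑ o ∈ A, sSup ((fun x => r x + m x o) '' N)
      ≤ ∑ o ∈ A, (1 + ∑ o' ∈ A, (P o + Q o') / 2) / A.card := Finset.sum_le_sum fun o _ => h1 o
    _ = 1 + ∑ o ∈ A, (P o + Q o) / 2 := by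
        simp only [← Finset.sum_div, Finset.sum_add_distrib, Finset.sum_const, nsmul_eq_mul,
          ← Finset.mul_sum]
        field_simp
    _ ≤ 1 + ∑ o ∈ A, B := by
        gcongr with o _
        linarith [hB o]
    _ = 1 + A.card * B := by simp

/-- Water filling. -/
lemma exists_prob_sub_le (hκ : 0 < κ) (R : Fin κ → ℝ) (B : ℝ)
    (h : ∀ A : Finset (Fin κ), ∑ o ∈ A, R o ≤ 1 + A.card * B) :
    ∃ q : Fin κ → ℝ, (∀ k, 0 ≤ q k) ∧ ∑ k, q k = 1 ∧ ∀ o, R o - q o ≤ B := by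
  have hκ' : (0 : ℝ) < κ := by exact_mod_cast hκ
  have hS : ∑ o, max (R o - B) 0 ≤ 1 := by
    have := h (Finset.univ.filter fun o => 0 ≤ R o - B)
    have h2 : ∑ o, max (R o - B) 0 = ∑ o with 0 ≤ R o - B, (R o - B) := by
      rw [Finset.sum_filter]
      refine Finset.sum_congr rfl fun o _ => ?_
      split_ifs with ho
      · exact max_eq_left ho
      · exact max_eq_right (not_le.mp ho).le
    rw [h2, Finset.sum_sub_distrib, Finset.sum_const, nsmul_eq_mul]
    linarith
  set s := ∑ o, max (R o - B) 0 with hs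
  have hslack : 0 ≤ (1 - s) / κ := div_nonneg (by linarith) hκ'.le
  refine ⟨fun o => max (R o - B) 0 + (1 - s) / κ,
    fun k => add_nonneg (le_max_right _ _) hslack, ?_, fun o => ?_⟩
  · rw [Finset.sum_add_distrib, ← hs, Finset.sum_const, nsmul_eq_mul, Finset.card_univ,
      Fintype.card_fin]
    field_simp
    ring
  · have := le_max_left (R o - B) 0
    linarith

end OneRound

section CondExp

variable {I : Type} [Fintype I] [DecidableEq I] {V : ℕ} {μ : (Fin V → I) → ℝ}

lemma condExp_congr {t : ℕ} {ι : Fin V → I} {f f' : (Fin V → I) → ℝ}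
    (h : ∀ ι', (∀ j : Fin V, (j : ℕ) < t → ι' j = ι j) → f ι' = f' ι') :
    condExp V μ t ι f = condExp V μ t ι f' := by
  unfold condExp
  congr 1
  refine Finset.sum_congr rfl fun ι' _ => ?_
  split_ifs with hι
  · rw [h ι' hι]
  · rfl

/-- The tower property. -/
lemma sum_mul_condExp (hμ0 : ∀ ι, 0 ≤ μ ι) (t : ℕ) (f : (Fin V → I) → ℝ) :
    ∑ ι, μ ι * condExp V μ t ι f = ∑ ι, μ ι * f ι := by
  let ag : (Fin V → I) → (Fin V → I) → Prop := fun ι' ι => ∀ j : Fin V, (j : ℕ) < t → ι' j = ι j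
  let Z : (Fin V → I) → ℝ := fun ι => ∑ ι', if ag ι' ι then μ ι' else 0
  have hZ : ∀ ι ι', ag ι' ι → Z ι = Z ι' := by
    intro ι ι' h
    refine Finset.sum_congr rfl fun ι'' _ => ?_
    have : ag ι'' ι ↔ ag ι'' ι' :=
      ⟨fun h' j hj => (h' j hj).trans (h j hj).symm, fun h' j hj => (h' j hj).trans (h j hj)⟩
    simp only [this]
  have hZs : ∀ ι', Z ι' = ∑ ι, if ag ι' ι then μ ι else 0 := fun ι' =>
    Finset.sum_congr rfl fun ι _ => by
      have : ag ι ι' ↔ ag ι' ι :=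
        ⟨fun h j hj => (h j hj).symm, fun h j hj => (h j hj).symm⟩
      simp only [this]
  have hle : ∀ ι, μ ι ≤ Z ι := by
    intro ι
    have h := Finset.single_le_sum (f := fun ι' => if ag ι' ι then μ ι' else 0)
      (fun ι' _ => by split_ifs; exacts [hμ0 _, le_rfl]) (Finset.mem_univ ι)
    simpa [ag] using h
  calc ∑ ι, μ ι * condExp V μ t ι f
      = ∑ ι, ∑ ι', (if ag ι' ι then μ ι else 0) * (μ ι' * f ι' / Z ι') := by
        refine Finset.sum_congr rfl fun ι _ => ?_
        show μ ι * ((∑ ι', if ag ι' ι then μ ι' * f ι' else 0) / Z ι) = _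
        rw [Finset.sum_div, Finset.mul_sum]
        refine Finset.sum_congr rfl fun ι' _ => ?_
        split_ifs with h
        · rw [hZ ι ι' h]
        · simp
    _ = ∑ ι', Z ι' * (μ ι' * f ι' / Z ι') := by
        rw [Finset.sum_comm]
        refine Finset.sum_congr rfl fun ι' _ => ?_
        rw [hZs ι', Finset.sum_mul]
    _ = ∑ ι', μ ι' * f ι' := by
        refine Finset.sum_congr rfl fun ι' _ => ?_
        rcases eq_or_ne (Z ι') 0 with h0 | h0
        · have : μ ι' = 0 := le_antisymm (h0 ▸ hle ι') (hμ0 ι')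
          simp [this]
        · field_simp

end CondExp

section Potential

variable {V κ : ℕ}

lemma sum_castLE {t : ℕ} (h : t ≤ V) (f : Fin V → ℝ) :
    ∑ s : Fin t, f (Fin.castLE h s) = ∑ j : Fin V, if (j : ℕ) < t then f j else 0 := by
  obtain ⟨d, rfl⟩ := Nat.exists_eq_add_of_le h
  rw [Fin.sum_univ_add]
  simp
  rfl

/-- The playout potential before round `t`: past rounds use the labels `y`, rounds from `t` on
are replaced by the signs `σ`. -/
noncomputable def playout (N : Set (Fin V → Fin κ → ℝ)) (y : Fin V → Fin κ) (t : ℕ)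
    (σ : Fin V × Fin κ → Bool) : ℝ :=
  sSup ((fun M => 2 * ∑ j : Fin V, ∑ k : Fin κ,
        (if t ≤ (j : ℕ) then sg (σ (j, k)) * M j k else 0)
      + ∑ j : Fin V, if (j : ℕ) < t then M j (y j) else 0) '' N)

lemma Robj_eq_playout (N : Set (Fin V → Fin κ → ℝ)) (y : Fin V → Fin κ) (t : Fin V)
    (σ : Fin V × Fin κ → Bool) :
    Robj V κ N t t.isLt (fun s => y (Fin.castLE t.isLt.le s)) σ (y t)
      = playout N y (t + 1) σ := by
  unfold Robj playout
  congr 1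
  refine Set.image_congr fun M _ => ?_
  rw [sum_castLE t.isLt.le (fun j => M j (y j)), add_assoc]
  congr 1
  have h : ∀ j : Fin V, (if (j : ℕ) < (t : ℕ) + 1 then M j (y j) else 0)
      = (if j = t then M j (y j) else 0) + if (j : ℕ) < t then M j (y j) else 0 := by
    intro j
    rcases lt_trichotomy (j : ℕ) t with h | h | h
    · rw [if_pos (by omega), if_neg (fun e => by simp [e] at h), if_pos h, zero_add]
    · rw [if_pos (by omega), if_pos (Fin.ext h), if_neg (by omega), add_zero]
    · rw [if_neg (by omega), if_neg (fun e => by simp [e] at h), if_neg (by omega), add_zero]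
  simp only [h, Finset.sum_add_distrib, Finset.sum_ite_eq', Finset.mem_univ, if_true]

/-- Signs at round `t` split off from a playout whose row `t` is resampled. -/
lemma playout_resample (N : Set (Fin V → Fin κ → ℝ)) (y : Fin V → Fin κ) (t : Fin V)
    (σ τ : Fin V × Fin κ → Bool) :
    playout N y t (fun p => if p.1 = t then τ p else σ p)
      = sSup ((fun M => (2 * ∑ j : Fin V, ∑ k : Fin κ,
            (if (t : ℕ) + 1 ≤ (j : ℕ) then sg (σ (j, k)) * M j k else 0)
          + ∑ s : Fin (t : ℕ), M (Fin.castLE t.isLt.le s) (y (Fin.castLE t.isLt.le s)))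
          + ∑ k, (2 * sg (τ (t, k))) * M t k) '' N) := by
  unfold playout
  congr 1
  refine Set.image_congr fun M _ => ?_
  rw [sum_castLE t.isLt.le (fun j => M j (y j))]
  have h : ∀ j : Fin V, ∑ k : Fin κ, (if (t : ℕ) ≤ (j : ℕ) then
        sg (if j = t then τ (j, k) else σ (j, k)) * M j k else 0)
      = (if j = t then ∑ k, sg (τ (j, k)) * M j k else 0)
        + ∑ k, if (t : ℕ) + 1 ≤ (j : ℕ) then sg (σ (j, k)) * M j k else 0 := by
    intro j
    by_cases hj : j = t
    · subst hj; simp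
    · have hne : (j : ℕ) ≠ t := fun e => hj (Fin.ext e)
      have : (t : ℕ) ≤ (j : ℕ) ↔ (t : ℕ) + 1 ≤ (j : ℕ) := by omega
      simp [hj, this]
  simp only [h, Finset.sum_add_distrib, Finset.sum_ite_eq', Finset.mem_univ, if_true]
  simp only [mul_assoc, ← Finset.mul_sum]
  ring

lemma sum_sg_mul_le {M : Fin V → Fin κ → ℝ} (hM : ∀ t k, M t k ∈ Set.Icc (0 : ℝ) 1)
    (σ : Fin V × Fin κ → Bool) (p : Fin V → Prop) [DecidablePred p] :
    ∑ j : Fin V, ∑ k : Fin κ, (if p j then sg (σ (j, k)) * M j k else 0) ≤ V * κ := by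
  calc _ ≤ ∑ _j : Fin V, ∑ _k : Fin κ, (1 : ℝ) := by
        refine Finset.sum_le_sum fun j _ => Finset.sum_le_sum fun k _ => ?_
        have h := hM j k
        split_ifs
        · cases σ (j, k) <;> simp [sg] <;> linarith [h.1, h.2]
        · exact zero_le_one
    _ = _ := by simp

/-- One round of the forecaster, for a fixed playout `σ`. -/
lemma one_round (hκ : 0 < κ) {N : Set (Fin V → Fin κ → ℝ)} (hN : N.Nonempty)
    (h01 : ∀ M ∈ N, ∀ t k, M t k ∈ Set.Icc (0 : ℝ) 1) (hrow : ∀ M ∈ N, ∀ t, ∑ k, M t k ≤ 1)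
    (y : Fin V → Fin κ) (t : Fin V) (σ : Fin V × Fin κ → Bool) (qh : Fin κ → ℝ)
    (hmin : ∀ q : Fin κ → ℝ, (∀ k, 0 ≤ q k) → (∑ k, q k = 1) →
      Finset.univ.sup' ⟨⟨0, hκ⟩, Finset.mem_univ _⟩
          (fun o => 1 - qh o
            + Robj V κ N t t.isLt (fun s => y (Fin.castLE t.isLt.le s)) σ o)
        ≤ Finset.univ.sup' ⟨⟨0, hκ⟩, Finset.mem_univ _⟩
          (fun o => 1 - q o
            + Robj V κ N t t.isLt (fun s => y (Fin.castLE t.isLt.le s)) σ o)) :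
    1 - qh (y t) ≤ 1 + ((2 : ℝ) ^ (V * κ))⁻¹ * ∑ τ : Fin V × Fin κ → Bool,
        playout N y t (fun p => if p.1 = t then τ p else σ p) - playout N y (t + 1) σ := by
  set B := ((2 : ℝ) ^ (V * κ))⁻¹ * ∑ τ : Fin V × Fin κ → Bool,
        playout N y t (fun p => if p.1 = t then τ p else σ p)
  set r : (Fin V → Fin κ → ℝ) → ℝ := fun M => 2 * ∑ j : Fin V, ∑ k : Fin κ,
            (if (t : ℕ) + 1 ≤ (j : ℕ) then sg (σ (j, k)) * M j k else 0)
          + ∑ s : Fin (t : ℕ), M (Fin.castLE t.isLt.le s) (y (Fin.castLE t.isLt.le s)) with hrdef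
  have hr : ∀ M ∈ N, r M ≤ 2 * (V * κ) + (t : ℕ) := by
    intro M hM
    refine add_le_add (mul_le_mul_of_nonneg_left
      (sum_sg_mul_le (h01 M hM) σ fun j => (t : ℕ) + 1 ≤ (j : ℕ)) zero_le_two) ?_
    calc _ ≤ ∑ _s : Fin (t : ℕ), (1 : ℝ) := Finset.sum_le_sum fun s _ => (h01 M hM _ _).2
      _ = _ := by simp
  have hm : ∀ M ∈ N, ∀ k, M t k ∈ Set.Icc (0 : ℝ) 1 := fun M hM k => h01 M hM t k
  have hB : ∀ o, sSup ((fun M => r M + 2 * M t o) '' N)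
      + sSup ((fun M => r M - 2 * M t o) '' N) ≤ 2 * B := by
    intro o
    have h := sSup_add_sSup_le_average hN (m := fun M => M t) hr hm
      (fun k => (t, k)) (Prod.mk_right_injective t) o
    simpa only [Fintype.card_prod, Fintype.card_fin, ← playout_resample N y t σ, hrdef] using h
  have hR : ∀ o, Robj V κ N t t.isLt (fun s => y (Fin.castLE t.isLt.le s)) σ o
      = sSup ((fun M => r M + M t o) '' N) := by
    intro o
    unfold Robj
    congr 1
    refine Set.image_congr fun M _ => ?_
    simp only [hrdef]
    ring
  obtain ⟨q, hq0, hq1, hq⟩ := exists_prob_sub_le hκ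
    (fun o => Robj V κ N t t.isLt (fun s => y (Fin.castLE t.isLt.le s)) σ o) B (fun A => by
      simp only [hR]
      exact sum_sSup_le hN (m := fun M => M t) hr hm (fun M hM => hrow M hM t) hB A)
  have h1 := (Finset.le_sup' (fun o => 1 - qh o
      + Robj V κ N t t.isLt (fun s => y (Fin.castLE t.isLt.le s)) σ o)
      (Finset.mem_univ (y t))).trans ((hmin q hq0 hq1).trans
        (Finset.sup'_le _ _ (a := 1 + B) fun o _ => by linarith [hq o]))
  rw [Robj_eq_playout] at h1
  linarith

/-- One round of the forecaster, averaged over playouts. -/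
lemma average_round (hκ : 0 < κ) {N : Set (Fin V → Fin κ → ℝ)} (hN : N.Nonempty)
    (h01 : ∀ M ∈ N, ∀ t k, M t k ∈ Set.Icc (0 : ℝ) 1) (hrow : ∀ M ∈ N, ∀ t, ∑ k, M t k ≤ 1)
    (y : Fin V → Fin κ) (t : Fin V) (qh : (Fin V × Fin κ → Bool) → Fin κ → ℝ)
    (hmin : ∀ σ, ∀ q : Fin κ → ℝ, (∀ k, 0 ≤ q k) → (∑ k, q k = 1) →
      Finset.univ.sup' ⟨⟨0, hκ⟩, Finset.mem_univ _⟩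
          (fun o => 1 - qh σ o
            + Robj V κ N t t.isLt (fun s => y (Fin.castLE t.isLt.le s)) σ o)
        ≤ Finset.univ.sup' ⟨⟨0, hκ⟩, Finset.mem_univ _⟩
          (fun o => 1 - q o
            + Robj V κ N t t.isLt (fun s => y (Fin.castLE t.isLt.le s)) σ o)) :
    ((2 : ℝ) ^ (V * κ))⁻¹ * ∑ σ, (1 - qh σ (y t))
      ≤ 1 + ((2 : ℝ) ^ (V * κ))⁻¹ * ∑ σ, playout N y t σ
        - ((2 : ℝ) ^ (V * κ))⁻¹ * ∑ σ, playout N y (t + 1) σ := by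
  have hc : (0 : ℝ) < 2 ^ (V * κ) := by positivity
  have h := Finset.sum_le_sum fun σ (_ : σ ∈ Finset.univ) =>
    one_round hκ hN h01 hrow y t σ (qh σ) (hmin σ)
  have h2 := sum_sum_piecewise (fun p : Fin V × Fin κ => p.1 = t) (playout N y t)
  rw [Fintype.card_prod, Fintype.card_fin, Fintype.card_fin] at h2
  rw [Finset.sum_sub_distrib (f := fun σ => 1 + _), Finset.sum_add_distrib, ← Finset.mul_sum, h2,
    inv_mul_cancel_left₀ hc.ne'] at h
  have h3 : ∑ _σ : Fin V × Fin κ → Bool, (1 : ℝ) = 2 ^ (V * κ) := by simp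
  rw [h3] at h
  calc _ ≤ ((2 : ℝ) ^ (V * κ))⁻¹ * (2 ^ (V * κ) + ∑ σ, playout N y t σ
        - ∑ σ, playout N y (t + 1) σ) := mul_le_mul_of_nonneg_left h (by positivity)
    _ = _ := by rw [mul_sub, mul_add, inv_mul_cancel₀ hc.ne']

/-- All rounds of the forecaster, averaged over playouts. -/
lemma sum_average_round (c : ℝ) (N : Set (Fin V → Fin κ → ℝ)) (y : Fin V → Fin κ)
    (l : Fin V → ℝ)
    (h : ∀ t : Fin V, l t ≤ 1 + c * ∑ σ, playout N y t σ - c * ∑ σ, playout N y (t + 1) σ) :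
    ∑ t, l t ≤ V + c * ∑ σ, playout N y 0 σ - c * ∑ σ, playout N y V σ := by
  refine (Finset.sum_le_sum fun t _ => h t).trans_eq ?_
  rw [Fin.sum_univ_eq_sum_range
    (fun t => 1 + c * ∑ σ, playout N y t σ - c * ∑ σ, playout N y (t + 1) σ) V]
  simp only [add_sub_assoc, Finset.sum_add_distrib, Finset.sum_range_sub']
  simp

end Potential

section Gap

variable {V κ : ℕ}

/-- The integrality gap converts relaxed solutions of budget `K` into integral ones of budget
`γ * K` that are at least as correlated with the signs. -/
lemma exists_integral_of_gap {E : Type*} {L : Finset (Fin V → Fin κ → ℝ)}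
    {g : (Fin V → Fin κ → ℝ) → ℝ} {S : Set E} {Φ : E → Fin V → Fin κ → ℝ} {G : E → ℝ}
    {γ K : ℝ} (hγ : 1 ≤ γ) (σ : Fin V × Fin κ → Bool)
    (hgap : ∀ D : ℝ, sInf ((fun m => (g m : EReal)) '' {m | m ∈ L ∧ D ≤ inn σ m})
        ≤ (γ : EReal) * sInf ((fun u => (G u : EReal)) '' {u ∈ S | D ≤ inn σ (Φ u)}))
    {u : E} (hu : u ∈ S) (hGu : G u ≤ K) :
    ∃ m ∈ L, g m ≤ γ * K ∧ inn σ (Φ u) ≤ inn σ m := by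
  set T := {m | m ∈ L ∧ inn σ (Φ u) ≤ inn σ m}
  have hle : sInf ((fun m => (g m : EReal)) '' T) ≤ ((γ * K : ℝ) : EReal) := by
    refine (hgap (inn σ (Φ u))).trans ?_
    rw [EReal.coe_mul]
    refine mul_le_mul_of_nonneg_left ?_ (by exact_mod_cast zero_le_one.trans hγ)
    exact sInf_le_of_le ⟨u, ⟨hu, le_rfl⟩, rfl⟩ (EReal.coe_le_coe_iff.mpr hGu)
  have hfin : T.Finite := L.finite_toSet.subset fun m hm => hm.1
  have hne : T.Nonempty := by
    by_contra hemp
    rw [Set.not_nonempty_iff_eq_empty.mp hemp, Set.image_empty, sInf_empty] at hle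
    exact absurd hle (not_le.mpr (EReal.coe_lt_top _))
  obtain ⟨m, hm, hmeq⟩ := (hne.image _).csInf_mem (hfin.image fun m => (g m : EReal))
  refine ⟨m, hm.1, ?_, hm.2⟩
  rw [← hmeq] at hle
  exact EReal.coe_le_coe_iff.mp hle

end Gap

/-- the main theorem.  Running the random-playout forecaster with
the relaxed matrix sets `𝓜(ι) = Φ_ι '' {u ∈ S(ι) : G_ι(u) ≤ K}` (e.g. the
projection of a level-`r` Lasserre feasible set) whose integrality gap is at
most `γ(ι)`, its expected regret with respect to the benchmark class
`G(ι) = {f : M_f ∈ L(ι), g_ι(M_f) ≤ K}` is at most twice the expected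
Rademacher complexity of the integral class with budget enlarged to `γ(ι)·K`. -/
theorem stmt_6 (V κ : ℕ) (hV : 0 < V) (hκ : 0 < κ)
    (I : Type) [Fintype I] [DecidableEq I] [Nonempty I]
    (μ : (Fin V → I) → ℝ) (hμ0 : ∀ ι, 0 ≤ μ ι) (hμ1 : ∑ ι, μ ι = 1)
    (K : ℝ) (hK : 0 ≤ K)
    -- integral solutions: a nonempty finite set of assignment matrices …
    (L : (Fin V → I) → Finset (Fin V → Fin κ → ℝ)) (hLne : ∀ ι, (L ι).Nonempty)
    (hLassign : ∀ ι, ∀ m ∈ L ι,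
      (∀ t k, m t k = 0 ∨ m t k = 1) ∧ ∀ t, ∑ k, m t k = 1)
    -- … with nonnegative cost, and nonempty budget-`K` sublevel set
    (g : (Fin V → I) → (Fin V → Fin κ → ℝ) → ℝ)
    (hg0 : ∀ ι, ∀ m ∈ L ι, 0 ≤ g ι m)
    (hFK : ∀ ι, {m | m ∈ L ι ∧ g ι m ≤ K}.Nonempty)
    -- the relaxation: a nonempty compact feasible set …
    (n : (Fin V → I) → ℕ)
    (S : (ι : Fin V → I) → Set (Fin (n ι) → ℝ))
    (hSne : ∀ ι, (S ι).Nonempty) (hSc : ∀ ι, IsCompact (S ι))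
    -- … a continuous projection to `[0,1]` matrices with row sums ≤ 1 …
    (Φ : (ι : Fin V → I) → (Fin (n ι) → ℝ) → (Fin V → Fin κ → ℝ))
    (hΦc : ∀ ι, ContinuousOn (Φ ι) (S ι))
    (hΦ01 : ∀ ι, ∀ u ∈ S ι, ∀ t k, Φ ι u t k ∈ Set.Icc (0 : ℝ) 1)
    (hΦrow : ∀ ι, ∀ u ∈ S ι, ∀ t, ∑ k, Φ ι u t k ≤ 1)
    -- … and a continuous relaxed cost under which every integral solution lifts
    (Gc : (ι : Fin V → I) → (Fin (n ι) → ℝ) → ℝ)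
    (hGcc : ∀ ι, ContinuousOn (Gc ι) (S ι)) (hGc0 : ∀ ι, ∀ u ∈ S ι, 0 ≤ Gc ι u)
    (hlift : ∀ ι, ∀ m ∈ L ι, ∃ u ∈ S ι, Φ ι u = m ∧ Gc ι u ≤ g ι m)
    -- the integrality-gap condition (infima in `EReal`: empty inf = ⊤)
    (γ : (Fin V → I) → ℝ) (hγ : ∀ ι, 1 ≤ γ ι)
    (hgap : ∀ (ι : Fin V → I) (σ : Fin V × Fin κ → Bool) (D : ℝ),
      sInf ((fun m => (g ι m : EReal)) '' {m | m ∈ L ι ∧ D ≤ inn σ m})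
        ≤ (γ ι : EReal) *
          sInf ((fun u => (Gc ι u : EReal)) '' {u ∈ S ι | D ≤ inn σ (Φ ι u)}))
    -- deterministic adaptive adversary
    (Y : (t : ℕ) → (Fin t → I) → Fin κ)
    -- the forecaster: probability vectors minimizing `q ↦ max_o [1 − q(o) + R_t(o)]`
    -- with the relaxed matrix set `𝓜(ι') = Φ_{ι'} '' {u ∈ S(ι') : G_{ι'}(u) ≤ K}`
    (qhat : (t : Fin V) → (Fin V → I) → (Fin (t : ℕ) → Fin κ) →
      (Fin V × Fin κ → Bool) → Fin κ → ℝ)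
    (hqhat0 : ∀ t ι' ys σ k, 0 ≤ qhat t ι' ys σ k)
    (hqhat1 : ∀ t ι' ys σ, ∑ k, qhat t ι' ys σ k = 1)
    (hqmin : ∀ (t : Fin V) (ι' : Fin V → I) (ys : Fin (t : ℕ) → Fin κ)
      (σ : Fin V × Fin κ → Bool) (q : Fin κ → ℝ),
      (∀ k, 0 ≤ q k) → (∑ k, q k = 1) →
      Finset.univ.sup' ⟨⟨0, hκ⟩, Finset.mem_univ _⟩
          (fun o => 1 - qhat t ι' ys σ o
            + Robj V κ (Φ ι' '' {u ∈ S ι' | Gc ι' u ≤ K}) (t : ℕ) t.isLt ys σ o)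
        ≤ Finset.univ.sup' ⟨⟨0, hκ⟩, Finset.mem_univ _⟩
          (fun o => 1 - q o
            + Robj V κ (Φ ι' '' {u ∈ S ι' | Gc ι' u ≤ K}) (t : ℕ) t.isLt ys σ o)) :
    -- expected regret w.r.t. `G(ι) = {f : M_f ∈ L(ι), g_ι(M_f) ≤ K}` is at most
    -- `2 E_ι Rad({m ∈ L(ι) : g_ι(m) ≤ γ(ι) K})`
    ∑ ι, μ ι *
        ((∑ t : Fin V, condExp V μ ((t : ℕ) + 1) ι (fun ι' =>
            ((2 : ℝ) ^ (V * κ))⁻¹ * ∑ σ : Fin V × Fin κ → Bool,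
              (1 - qhat t ι'
                (fun s : Fin (t : ℕ) => Y ((s : ℕ) + 1)
                  (fun i => ι (Fin.castLE (Nat.succ_le_of_lt (lt_trans s.isLt t.isLt)) i)))
                σ
                (Y ((t : ℕ) + 1) (fun i => ι (Fin.castLE t.isLt i))))))
          - sInf ((fun f => ∑ t : Fin V,
                if f t ≠ Y ((t : ℕ) + 1) (fun i => ι (Fin.castLE t.isLt i)) then (1 : ℝ) else 0) ''
              {f : Fin V → Fin κ | Mf f ∈ L ι ∧ g ι (Mf f) ≤ K}))
      ≤ 2 * ∑ ι, μ ι * radSet V κ {m | m ∈ L ι ∧ g ι m ≤ γ ι * K} := by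
  classical
  let N : (Fin V → I) → Set (Fin V → Fin κ → ℝ) := fun ι => Φ ι '' {u ∈ S ι | Gc ι u ≤ K}
  let y : (Fin V → I) → Fin V → Fin κ := fun ι t =>
    Y ((t : ℕ) + 1) (fun i => ι (Fin.castLE t.isLt i))
  set c : ℝ := ((2 : ℝ) ^ (V * κ))⁻¹ with hc
  have hc0 : 0 ≤ c := by positivity
  have mem_N : ∀ ι, ∀ m ∈ L ι, g ι m ≤ K → m ∈ N ι := by
    intro ι m hm hg
    obtain ⟨u, hu, rfl, hG⟩ := hlift ι m hm
    exact ⟨u, ⟨hu, hG.trans hg⟩, rfl⟩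
  have hN : ∀ ι, (N ι).Nonempty := fun ι =>
    let ⟨m, hm, hg⟩ := hFK ι
    ⟨m, mem_N ι m hm hg⟩
  have h01 : ∀ ι, ∀ M ∈ N ι, ∀ t k, M t k ∈ Set.Icc (0 : ℝ) 1 := by
    rintro ι _ ⟨u, hu, rfl⟩
    exact hΦ01 ι u hu.1
  have hrow : ∀ ι, ∀ M ∈ N ι, ∀ t, ∑ k, M t k ≤ 1 := by
    rintro ι _ ⟨u, hu, rfl⟩
    exact hΦrow ι u hu.1
  let loss : Fin V → (Fin V → I) → ℝ := fun t ι =>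
    c * ∑ σ, (1 - qhat t ι (fun s => y ι (Fin.castLE t.isLt.le s)) σ (y ι t))
  have hloss : ∀ ι, ∑ t, loss t ι ≤ V + c * ∑ σ, playout (N ι) (y ι) 0 σ
      - c * ∑ σ, playout (N ι) (y ι) V σ := fun ι =>
    sum_average_round c (N ι) (y ι) (fun t => loss t ι) fun t =>
      average_round hκ (hN ι) (h01 ι) (hrow ι) (y ι) t
        (fun σ => qhat t ι (fun s => y ι (Fin.castLE t.isLt.le s)) σ)
        (fun σ => hqmin t ι _ σ)
  have hstart : ∀ ι, c * ∑ σ, playout (N ι) (y ι) 0 σ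
      ≤ 2 * radSet V κ {m | m ∈ L ι ∧ g ι m ≤ γ ι * K} := by
    intro ι
    unfold radSet
    rw [mul_left_comm, Finset.mul_sum (a := (2 : ℝ))]
    refine mul_le_mul_of_nonneg_left (Finset.sum_le_sum fun σ _ => ?_) hc0
    refine csSup_le ((hN ι).image _) ?_
    rintro _ ⟨_, ⟨u, hu, rfl⟩, rfl⟩
    obtain ⟨m, hm, hgm, hle⟩ := exists_integral_of_gap (hγ ι) σ (hgap ι σ) hu.1 hu.2
    have hfin : {m | m ∈ L ι ∧ g ι m ≤ γ ι * K}.Finite :=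
      (L ι).finite_toSet.subset fun m hm => hm.1
    have hsup : inn σ m ≤ sSup (inn σ '' {m | m ∈ L ι ∧ g ι m ≤ γ ι * K}) :=
      le_csSup (hfin.image _).bddAbove (Set.mem_image_of_mem _ ⟨hm, hgm⟩)
    have hrel := hle.trans hsup
    simp only [zero_le, if_true, not_lt_zero, if_false, Finset.sum_const_zero, add_zero]
    exact mul_le_mul_of_nonneg_left hrel zero_le_two
  have hend : ∀ ι, V - c * ∑ σ, playout (N ι) (y ι) V σ
      ≤ sInf ((fun f => ∑ t : Fin V, if f t ≠ y ι t then (1 : ℝ) else 0) ''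
          {f : Fin V → Fin κ | Mf f ∈ L ι ∧ g ι (Mf f) ≤ K}) := by
    intro ι
    refine le_csInf (Set.Nonempty.image _ ?_) ?_
    · obtain ⟨m, hm, hg⟩ := hFK ι
      obtain ⟨hbin, hsum⟩ := hLassign ι m hm
      have hex : ∀ t, ∃ k, m t k = 1 := by
        intro t
        by_contra! hno
        have h0 : ∀ k, m t k = 0 := fun k => (hbin t k).resolve_right (hno k)
        have := hsum t
        simp [h0] at this
      choose f hf using hex
      have hmf : Mf f = m := by
        funext t k
        unfold Mf
        split_ifs with h
        · rw [← h, hf]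
        · refine ((hbin t k).resolve_right fun h1 => ?_).symm
          have h2 : ∑ j ∈ {f t, k}, m t j ≤ ∑ j, m t j :=
            Finset.sum_le_sum_of_subset_of_nonneg (Finset.subset_univ _) fun j _ _ => by
              rcases hbin t j with h | h <;> simp [h]
          rw [Finset.sum_pair h, hf, h1, hsum] at h2
          norm_num at h2
      exact ⟨f, by rwa [hmf], by rwa [hmf]⟩
    · rintro _ ⟨f, ⟨hfL, hfg⟩, rfl⟩
      have hbd : ∀ σ, ∑ t, Mf f t (y ι t) ≤ playout (N ι) (y ι) V σ := by
        intro σ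
        refine le_csSup ⟨2 * (V * κ) + V, ?_⟩ ⟨Mf f, mem_N ι _ hfL hfg, ?_⟩
        · rintro _ ⟨M, hM, rfl⟩
          refine add_le_add (mul_le_mul_of_nonneg_left
            (sum_sg_mul_le (h01 ι M hM) σ fun j => V ≤ (j : ℕ)) zero_le_two) ?_
          calc _ ≤ ∑ _j : Fin V, (1 : ℝ) := Finset.sum_le_sum fun j _ => by
                rw [if_pos j.isLt]; exact (h01 ι M hM _ _).2
            _ = _ := by simp
        · simp [fun j : Fin V => not_le.mpr j.isLt]
      have havg : ∑ t, Mf f t (y ι t) ≤ c * ∑ σ, playout (N ι) (y ι) V σ := by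
        have h := Finset.sum_le_sum fun σ (_ : σ ∈ Finset.univ) => hbd σ
        rw [Finset.sum_const, nsmul_eq_mul] at h
        have h3 : ((Finset.univ : Finset (Fin V × Fin κ → Bool)).card : ℝ) = 2 ^ (V * κ) := by
          simp
        rw [h3] at h
        rw [hc, inv_mul_eq_div, le_div_iff₀ (by positivity)]
        linarith
      have hsplit : ∑ t, Mf f t (y ι t) + ∑ t, (if f t ≠ y ι t then (1 : ℝ) else 0) = V := by
        rw [← Finset.sum_add_distrib]
        calc _ = ∑ _t : Fin V, (1 : ℝ) := Finset.sum_congr rfl fun t _ => by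
              by_cases h : f t = y ι t <;> simp [Mf, h]
          _ = V := by simp
      show _ ≤ ∑ t, (if f t ≠ y ι t then (1 : ℝ) else 0)
      linarith
  have hy : ∀ (t : ℕ) (ι ι' : Fin V → I), (∀ j : Fin V, (j : ℕ) < t + 1 → ι' j = ι j) →
      ∀ s : Fin V, (s : ℕ) ≤ t → y ι s = y ι' s := by
    intro t ι ι' h s hs
    refine congrArg (Y ((s : ℕ) + 1)) (funext fun i => (h _ ?_).symm)
    have := i.isLt
    simp only [Fin.val_castLE]
    omega
  have hcond : ∀ (t : Fin V) (ι : Fin V → I), condExp V μ ((t : ℕ) + 1) ι (fun ι' =>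
        c * ∑ σ, (1 - qhat t ι' (fun s => y ι (Fin.castLE t.isLt.le s)) σ (y ι t)))
      = condExp V μ ((t : ℕ) + 1) ι (loss t) := by
    intro t ι
    refine condExp_congr fun ι' h => ?_
    have h1 : (fun s : Fin (t : ℕ) => y ι (Fin.castLE t.isLt.le s))
        = fun s => y ι' (Fin.castLE t.isLt.le s) :=
      funext fun s => hy t ι ι' h _ s.isLt.le
    simp only [loss, h1, hy t ι ι' h t le_rfl]
  have htower : ∑ ι, μ ι * ∑ t : Fin V, condExp V μ ((t : ℕ) + 1) ι (fun ι' =>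
        c * ∑ σ, (1 - qhat t ι' (fun s => y ι (Fin.castLE t.isLt.le s)) σ (y ι t)))
      = ∑ ι, μ ι * ∑ t, loss t ι := by
    calc _ = ∑ ι, ∑ t : Fin V, μ ι * condExp V μ ((t : ℕ) + 1) ι (loss t) :=
          Finset.sum_congr rfl fun ι _ => by
            rw [Finset.sum_congr rfl fun t _ => hcond t ι, Finset.mul_sum]
      _ = ∑ t : Fin V, ∑ ι, μ ι * loss t ι := by
          rw [Finset.sum_comm]
          exact Finset.sum_congr rfl fun t _ => sum_mul_condExp hμ0 _ (loss t)
      _ = _ := by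
          rw [Finset.sum_comm]
          exact Finset.sum_congr rfl fun ι _ => (Finset.mul_sum _ _ _).symm
  have hfinal : ∑ ι, μ ι * ∑ t, loss t ι
      - ∑ ι, μ ι * sInf ((fun f => ∑ t : Fin V, if f t ≠ y ι t then (1 : ℝ) else 0) ''
          {f : Fin V → Fin κ | Mf f ∈ L ι ∧ g ι (Mf f) ≤ K})
      ≤ 2 * ∑ ι, μ ι * radSet V κ {m | m ∈ L ι ∧ g ι m ≤ γ ι * K} := by
    rw [← Finset.sum_sub_distrib, Finset.mul_sum]
    refine Finset.sum_le_sum fun ι _ => ?_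
    rw [← mul_sub, mul_left_comm]
    exact mul_le_mul_of_nonneg_left (by linarith [hloss ι, hstart ι, hend ι]) (hμ0 ι)
  rw [← htower, ← Finset.sum_sub_distrib] at hfinal
  simp only [← mul_sub] at hfinal
  exact hfinal

end Stmt6
end

section
/- Let n ≥ 1, S ⊆ ℝ^n nonempty and compact, G : S → [0,∞) continuous, Y ∈ ℝ^n, and K ≥ 0 with {u ∈ S : G(u) ≤ K} nonempty. Then max{ ⟨Y,u⟩ : u ∈ S, G(u) ≤ K } = sup{ A ∈ ℝ : inf{ G(u) : u ∈ S, ⟨Y,u⟩ ≥ A } ≤ K }, where the infimum over an empty set is interpreted as +∞. -/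
/-- the first-form constrained maximization program (maximize the
linear objective subject to constraint cost at most `K`) equals the supremum of
the levels `A` for which the second-form program (minimize the constraint cost
subject to the linear objective being at least `A`) has value at most `K`; the
second-form infimum is taken in `EReal`, so over an empty feasible set it is
`⊤ = +∞`. -/
theorem stmt_7 (n : ℕ) (hn : 1 ≤ n)
    (S : Set (Fin n → ℝ)) (hSne : S.Nonempty) (hSc : IsCompact S)
    (G : (Fin n → ℝ) → ℝ) (hGc : ContinuousOn G S) (hG0 : ∀ u ∈ S, 0 ≤ G u)
    (Y : Fin n → ℝ) (K : ℝ) (hK : 0 ≤ K)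
    (hfeas : {u ∈ S | G u ≤ K}.Nonempty) :
    sSup ((fun u => ∑ i, Y i * u i) '' {u ∈ S | G u ≤ K})
      = sSup {A : ℝ |
          sInf ((fun u => (G u : EReal)) '' {u ∈ S | A ≤ ∑ i, Y i * u i}) ≤ (K : EReal)} := by
  have hL : Continuous fun u : Fin n → ℝ => ∑ i, Y i * u i := by fun_prop
  have hTc : IsCompact {u ∈ S | G u ≤ K} :=
    hSc.of_isClosed_subset
      (hGc.preimage_isClosed_of_isClosed hSc.isClosed isClosed_Iic) fun _ hu => hu.1
  obtain ⟨w, hw, hmax⟩ := hTc.exists_isMaxOn hfeas hL.continuousOn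
  have hgreatest : IsGreatest ((fun u => ∑ i, Y i * u i) '' {u ∈ S | G u ≤ K})
      (∑ i, Y i * w i) :=
    ⟨⟨w, hw, rfl⟩, by rintro _ ⟨u, hu, rfl⟩; exact hmax hu⟩
  have hlevels : {A : ℝ |
      sInf ((fun u => (G u : EReal)) '' {u ∈ S | A ≤ ∑ i, Y i * u i}) ≤ (K : EReal)}
      = Set.Iic (∑ i, Y i * w i) := by
    ext A
    simp only [Set.mem_ofPred_eq, Set.mem_Iic]
    constructor
    · intro h
      rcases Set.eq_empty_or_nonempty {u ∈ S | A ≤ ∑ i, Y i * u i} with he | hne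
      · simp [he] at h
      · have hAc : IsCompact {u ∈ S | A ≤ ∑ i, Y i * u i} :=
          hSc.inter_right (isClosed_le continuous_const hL)
        obtain ⟨v, hv, hmin⟩ := hAc.exists_isMinOn hne (hGc.mono fun _ hu => hu.1)
        have hvK : (G v : EReal) ≤ K := by
          refine le_trans (le_sInf ?_) h
          rintro _ ⟨u, hu, rfl⟩
          exact EReal.coe_le_coe_iff.2 (hmin hu)
        exact hv.2.trans (hmax (show v ∈ {u ∈ S | G u ≤ K} from
          ⟨hv.1, EReal.coe_le_coe_iff.1 hvK⟩))
    · intro h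
      exact sInf_le_of_le ⟨w, ⟨hw.1, h⟩, rfl⟩ (EReal.coe_le_coe_iff.2 hw.2)
  rw [hgreatest.csSup_eq, hlevels, csSup_Iic]
end

section
/- Let W be a nonempty set, M : W → [0,1]^{V×κ} a map such that Σ_{k=1}^κ M(w)_{t,k} = 1 for every w ∈ W and every row t, let c : W → [0,∞), and fix λ ≥ 0 and K ≥ 0. For a label prefix (y_1,…,y_t) ∈ [κ]^t define Rel(y_1,…,y_t) := 2^{−(V−t)κ} Σ_{ε∈{−1,1}^{(V−t)×κ}} sup_{w∈W} [ 2 Σ_{j=t+1}^V Σ_{k=1}^κ ε_{j,k} M(w)_{j,k} + Σ_{s=1}^t M(w)_{s,y_s} − λ c(w) ] − t + λK. Let G be a nonempty finite set of label sequences such that for every f ∈ G there exists w ∈ W with M(w) = M_f and c(w) ≤ K. Then: (a) for every (y_1,…,y_V) ∈ [κ]^V, Rel(y_1,…,y_V) ≥ −min_{f∈G} Σ_{t=1}^V 1{f(t)≠y_t}; and (b) for every 1 ≤ t ≤ V and (y_1,…,y_{t−1}) ∈ [κ]^{t−1}, if for each ε ∈ {−1,1}^{(V−t)×κ} one lets q̂(ε)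 be any probability vector on [κ] minimizing q ↦ max_{y∈[κ]} [ 1 − q(y) + sup_{w∈W} ( 2 Σ_{j=t+1}^V Σ_{k=1}^κ ε_{j,k} M(w)_{j,k} + M(w)_{t,y} + Σ_{s=1}^{t−1} M(w)_{s,y_s} − λ c(w) ) ], then max_{y∈[κ]} [ 2^{−(V−t)κ} Σ_{ε} (1 − q̂(ε)(y)) + Rel(y_1,…,y_{t−1},y) ] ≤ Rel(y_1,…,y_{t−1}). Hence Rel is an admissible relaxation for G. -/
namespace Stmt8

/-- Rademacher sign of a Boolean. -/
def sg (b : Bool) : ℝ := if b then 1 else -1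

/-- The penalized (Lagrangian) Rademacher-based relaxation of the paper,
evaluated at the label prefix `ys` of length `t` (rows 0-indexed; the future
rows are those `j` with `t ≤ j`).  The average over the future Rademacher signs
is written as an average over sign assignments of all `V × κ` entries, which
equals the stated average since the summand does not depend on the first `t`
rows of signs. -/
noncomputable def relaxPen (V κ : ℕ) (W : Type) [Nonempty W]
    (M : W → Fin V → Fin κ → ℝ) (c : W → ℝ) (lam K : ℝ)
    (t : ℕ) (h : t ≤ V) (ys : Fin t → Fin κ) : ℝ :=
  ((2 : ℝ) ^ (V * κ))⁻¹ * (∑ σ : Fin V × Fin κ → Bool,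
      ⨆ w : W, (2 * ∑ j : Fin V, ∑ k : Fin κ,
            (if t ≤ (j : ℕ) then sg (σ (j, k)) * M w j k else 0)
          + ∑ s : Fin t, M w (Fin.castLE h s) (ys s) - lam * c w))
    - t + lam * K

/-- The penalized quantity `R_t(o)` at 0-indexed round `t` (past labels `ys` of
length `t`): future rows `j` with `t + 1 ≤ j`, current row `t`, past rows with
the observed labels, minus the penalty `λ·c(w)`. -/
noncomputable def RobjPen (V κ : ℕ) (W : Type) [Nonempty W]
    (M : W → Fin V → Fin κ → ℝ) (c : W → ℝ) (lam : ℝ)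
    (t : ℕ) (ht : t < V) (ys : Fin t → Fin κ)
    (σ : Fin V × Fin κ → Bool) (o : Fin κ) : ℝ :=
  ⨆ w : W, (2 * ∑ j : Fin V, ∑ k : Fin κ,
        (if t + 1 ≤ (j : ℕ) then sg (σ (j, k)) * M w j k else 0)
      + M w ⟨t, ht⟩ o + ∑ s : Fin t, M w (Fin.castLE ht.le s) (ys s) - lam * c w)

lemma sg_not (b : Bool) : sg (!b) = -sg b := by
  cases b <;> simp [sg]

lemma abs_sg (b : Bool) : |sg b| = 1 := by
  cases b <;> simp [sg]

lemma involutive_xor {ι : Type*} (a : ι → Bool) :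
    Function.Involutive (fun (τ : ι → Bool) i => xor (a i) (τ i)) := by
  intro τ
  funext i
  simp

lemma sum_comp_xor {ι : Type*} [Fintype ι] [DecidableEq ι] (a : ι → Bool)
    (g : (ι → Bool) → ℝ) : ∑ τ : ι → Bool, g (fun i => xor (a i) (τ i)) = ∑ τ, g τ :=
  (involutive_xor a).bijective.sum_comp g

/-- The average of the suprema of a Rademacher process dominates the average with all signs but
one integrated out. -/
lemma iSup_add_iSup_le_sum {W ι : Type*} [Nonempty W] [Fintype ι] [DecidableEq ι]
    (A : W → ℝ) (m : W → ι → ℝ)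
    (hbdd : ∀ τ : ι → Bool, BddAbove (Set.range fun w => A w + 2 * ∑ k, sg (τ k) * m w k))
    (y : ι) :
    (2 : ℝ) ^ Fintype.card ι * ((⨆ w, (A w + 2 * m w y)) + ⨆ w, (A w - 2 * m w y))
      ≤ 2 * ∑ τ : ι → Bool, ⨆ w, (A w + 2 * ∑ k, sg (τ k) * m w k) := by
  set g : (ι → Bool) → ℝ := fun τ => ⨆ w, (A w + 2 * ∑ k, sg (τ k) * m w k) with hg
  have single (w : W) (τ : ι → Bool) :
      ∑ k, sg (τ k) * m w k + ∑ k, sg (xor (decide (k ≠ y)) (τ k)) * m w k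
        = 2 * (sg (τ y) * m w y) := by
    rw [← Finset.sum_add_distrib, Finset.sum_eq_single y]
    · simp; ring
    · intro k _ hk
      simp [hk, sg_not]
    · simp
  have pair (τ : ι → Bool) (w : W) :
      2 * (A w + 2 * (sg (τ y) * m w y)) ≤ g τ + g (fun k => xor (decide (k ≠ y)) (τ k)) := by
    have h1 := le_ciSup (hbdd τ) w
    have h2 := le_ciSup (hbdd fun k => xor (decide (k ≠ y)) (τ k)) w
    have h3 := single w τ
    simp only [hg]
    linarith
  have four (τ : ι → Bool) :
      2 * ((⨆ w, (A w + 2 * m w y)) + ⨆ w, (A w - 2 * m w y))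
        ≤ g τ + g (fun k => xor (decide (k ≠ y)) (τ k)) + (g (fun k => xor true (τ k))
          + g (fun k => xor (decide (k ≠ y)) (xor true (τ k)))) := by
    have hb (τ : ι → Bool) : (⨆ w, (A w + 2 * (sg (τ y) * m w y)))
        ≤ (g τ + g (fun k => xor (decide (k ≠ y)) (τ k))) / 2 :=
      ciSup_le fun w => by linarith [pair τ w]
    have h1 := hb τ
    have h2 := hb (fun k => xor true (τ k))
    cases hy : τ y <;> simp [hy, sg] at h1 h2 ⊢ <;> simp only [sub_eq_add_neg] <;> linarith
  have hsum := Finset.sum_le_sum fun τ (_ : τ ∈ (Finset.univ : Finset (ι → Bool))) => four τ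
  simp only [Finset.sum_add_distrib] at hsum
  rw [sum_comp_xor (fun k => decide (k ≠ y)) g, sum_comp_xor (fun _ => true) g,
    sum_comp_xor (fun _ => true) (fun τ => g (fun k => xor (decide (k ≠ y)) (τ k))),
    sum_comp_xor (fun k => decide (k ≠ y)) g] at hsum
  simp only [Finset.sum_const, Finset.card_univ, Fintype.card_fun, Fintype.card_bool,
    nsmul_eq_mul, Nat.cast_pow, Nat.cast_ofNat] at hsum
  linarith

/-- Some mixed label strategy guarantees a regret increment of at most the average of the
suprema of the Rademacher process. -/
lemma exists_prob_iSup_sub_le {W ι : Type*} [Nonempty W] [Fintype ι] [DecidableEq ι] [Nonempty ι]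
    (A : W → ℝ) (m : W → ι → ℝ) (hA : BddAbove (Set.range A))
    (hm0 : ∀ w k, 0 ≤ m w k) (hm1 : ∀ w, ∑ k, m w k = 1) :
    ∃ q : ι → ℝ, (∀ k, 0 ≤ q k) ∧ ∑ k, q k = 1 ∧ ∀ y, (⨆ w, (A w + m w y)) - q y
      ≤ ((2 : ℝ) ^ Fintype.card ι)⁻¹ *
          ∑ τ : ι → Bool, ⨆ w, (A w + 2 * ∑ k, sg (τ k) * m w k) := by
  obtain ⟨B, hB⟩ := hA
  have hB (w : W) : A w ≤ B := hB ⟨w, rfl⟩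
  have hmle (w : W) (k : ι) : m w k ≤ 1 :=
    hm1 w ▸ Finset.single_le_sum (fun i _ => hm0 w i) (Finset.mem_univ k)
  have hbdd (τ : ι → Bool) :
      BddAbove (Set.range fun w => A w + 2 * ∑ k, sg (τ k) * m w k) := by
    refine ⟨B + 2, ?_⟩
    rintro _ ⟨w, rfl⟩
    have : ∑ k, sg (τ k) * m w k ≤ ∑ k, m w k :=
      Finset.sum_le_sum fun k _ =>
        mul_le_of_le_one_left (hm0 w k) ((le_abs_self _).trans (abs_sg _).le)
    have := hm1 w
    have := hB w
    dsimp only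
    linarith
  set E : ℝ := ((2 : ℝ) ^ Fintype.card ι)⁻¹ *
    ∑ τ : ι → Bool, ⨆ w, (A w + 2 * ∑ k, sg (τ k) * m w k) with hE
  set R : ι → ℝ := fun y => ⨆ w, (A w + m w y) with hR
  set Fp : ι → ℝ := fun y => ⨆ w, (A w + 2 * m w y) with hFp
  set Fm : ι → ℝ := fun y => ⨆ w, (A w - 2 * m w y) with hFm
  have hFE (y : ι) : Fp y + Fm y ≤ 2 * E := by
    have h := iSup_add_iSup_le_sum A m hbdd y
    have hpos : (0 : ℝ) < 2 ^ Fintype.card ι := by positivity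
    rw [mul_comm, ← le_div_iff₀ hpos] at h
    calc Fp y + Fm y ≤ _ := h
      _ = 2 * E := by rw [hE]; ring
  have hp (w : W) (y : ι) : A w + 2 * m w y ≤ Fp y :=
    le_ciSup (f := fun w => A w + 2 * m w y)
      ⟨B + 2, by rintro _ ⟨w, rfl⟩; dsimp only; linarith [hB w, hmle w y]⟩ w
  have hn (w : W) (y : ι) : A w - 2 * m w y ≤ Fm y :=
    le_ciSup (f := fun w => A w - 2 * m w y)
      ⟨B, by rintro _ ⟨w, rfl⟩; dsimp only; linarith [hB w, hm0 w y]⟩ w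
  have hP (P : Finset ι) : ∑ y ∈ P, (R y - E) ≤ 1 := by
    rcases P.eq_empty_or_nonempty with rfl | hne
    · simp
    have hcard : (0 : ℝ) < P.card := by exact_mod_cast hne.card_pos
    have hRy (y : ι) : (P.card : ℝ) * R y
        ≤ 1 + (P.card * Fp y + ∑ k ∈ P, Fm k) / 2 := by
      rw [mul_comm, ← le_div_iff₀ hcard]
      refine ciSup_le fun w => ?_
      rw [le_div_iff₀ hcard]
      have h1 : ∑ k ∈ P, m w k ≤ 1 := hm1 w ▸
        Finset.sum_le_sum_of_subset_of_nonneg (Finset.subset_univ P) fun k _ _ => hm0 w k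
      have h2 : ∑ k ∈ P, (A w - 2 * m w k) ≤ ∑ k ∈ P, Fm k :=
        Finset.sum_le_sum fun k _ => hn w k
      rw [Finset.sum_sub_distrib, ← Finset.mul_sum, Finset.sum_const, nsmul_eq_mul] at h2
      have h3 := mul_le_mul_of_nonneg_left (hp w y) hcard.le
      linarith
    have h1 := Finset.sum_le_sum fun y (_ : y ∈ P) => hRy y
    have h2 := Finset.sum_le_sum fun y (_ : y ∈ P) => hFE y
    simp only [← Finset.mul_sum, Finset.sum_add_distrib, ← Finset.sum_div, Finset.sum_const,
      nsmul_eq_mul, mul_one] at h1 h2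
    rw [Finset.sum_sub_distrib, Finset.sum_const, nsmul_eq_mul]
    refine le_of_mul_le_mul_left ?_ hcard
    have h3 := mul_le_mul_of_nonneg_left h2 hcard.le
    linarith
  set d : ι → ℝ := fun y => max (R y - E) 0 with hd
  have hdsum : ∑ y, d y ≤ 1 := by
    have h : ∑ y, d y = ∑ y ∈ Finset.univ.filter (fun y => 0 ≤ R y - E), (R y - E) := by
      rw [Finset.sum_filter]
      refine Finset.sum_congr rfl fun y _ => ?_
      by_cases h : 0 ≤ R y - E
      · simp only [hd, max_eq_left h, if_pos h]
      · simp only [hd, max_eq_right (not_le.mp h).le, if_neg h]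
    exact h ▸ hP _
  obtain ⟨k₀⟩ := ‹Nonempty ι›
  refine ⟨fun y => d y + if y = k₀ then 1 - ∑ k, d k else 0, fun k => ?_, ?_, fun y => ?_⟩
  · have : 0 ≤ d k := le_max_right _ _
    dsimp only
    split_ifs <;> linarith
  · simp [Finset.sum_add_distrib]
  · have : R y - E ≤ d y := le_max_left _ _
    dsimp only
    split_ifs <;> linarith

lemma sum_future_rows_eq {V κ : ℕ} {t : ℕ} (ht : t < V) (a : Fin V → Fin κ → ℝ) :
    ∑ j : Fin V, ∑ k, (if t ≤ (j : ℕ) then a j k else 0)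
      = ∑ j : Fin V, ∑ k, (if t + 1 ≤ (j : ℕ) then a j k else 0) + ∑ k, a ⟨t, ht⟩ k := by
  have h : ∑ k, a ⟨t, ht⟩ k
      = ∑ j : Fin V, if j = ⟨t, ht⟩ then ∑ k, a j k else 0 := by
    simp
  rw [h, ← Finset.sum_add_distrib]
  refine Finset.sum_congr rfl fun j _ => ?_
  rcases lt_trichotomy t (j : ℕ) with hj | hj | hj
  · simp [hj.le, Nat.succ_le_of_lt hj, Fin.ext_iff, hj.ne']
  · simp [Fin.ext_iff, ← hj]
  · simp [Fin.ext_iff, hj.ne, not_le.mpr hj, not_le.mpr (hj.trans (Nat.lt_succ_self _))]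

lemma bddAbove_penalized_process {V κ : ℕ} {W : Type} {M : W → Fin V → Fin κ → ℝ} {c : W → ℝ}
    (hM01 : ∀ w t k, M w t k ∈ Set.Icc (0 : ℝ) 1) (hc0 : ∀ w, 0 ≤ c w)
    {lam : ℝ} (hlam : 0 ≤ lam) (n t : ℕ) (h : t ≤ V) (ys : Fin t → Fin κ)
    (σ : Fin V × Fin κ → Bool) :
    BddAbove (Set.range fun w => 2 * ∑ j : Fin V, ∑ k : Fin κ,
        (if n ≤ (j : ℕ) then sg (σ (j, k)) * M w j k else 0)
      + ∑ s : Fin t, M w (Fin.castLE h s) (ys s) - lam * c w) := by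
  refine ⟨2 * ∑ _j : Fin V, ∑ _k : Fin κ, (1 : ℝ) + ∑ _s : Fin t, (1 : ℝ), ?_⟩
  rintro _ ⟨w, rfl⟩
  have h1 : ∑ j : Fin V, ∑ k : Fin κ, (if n ≤ (j : ℕ) then sg (σ (j, k)) * M w j k else 0)
      ≤ ∑ _j : Fin V, ∑ _k : Fin κ, (1 : ℝ) := by
    refine Finset.sum_le_sum fun j _ => Finset.sum_le_sum fun k _ => ?_
    split_ifs
    · exact (mul_le_of_le_one_left (hM01 w j k).1
        ((le_abs_self _).trans (abs_sg _).le)).trans (hM01 w j k).2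
    · exact zero_le_one
  have h2 : ∑ s : Fin t, M w (Fin.castLE h s) (ys s) ≤ ∑ _s : Fin t, (1 : ℝ) :=
    Finset.sum_le_sum fun s _ => (hM01 w _ _).2
  have h3 := mul_nonneg hlam (hc0 w)
  dsimp only
  linarith

lemma inv_two_pow_mul_sum_const (V κ : ℕ) (a : ℝ) :
    ((2 : ℝ) ^ (V * κ))⁻¹ * ∑ _σ : Fin V × Fin κ → Bool, a = a := by
  simp

/-- The relaxation after one more label, as an average of the current-round objectives. -/
lemma relaxPen_snoc {V κ : ℕ} {W : Type} [Nonempty W]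
    (M : W → Fin V → Fin κ → ℝ) (c : W → ℝ) (lam K : ℝ)
    {t : ℕ} (ht : t < V) (ys : Fin t → Fin κ) (y : Fin κ) :
    relaxPen V κ W M c lam K (t + 1) ht (Fin.snoc ys y)
      = ((2 : ℝ) ^ (V * κ))⁻¹ * (∑ σ, RobjPen V κ W M c lam t ht ys σ y)
        - (t + 1) + lam * K := by
  unfold relaxPen RobjPen
  push_cast
  congr 3
  refine Finset.sum_congr rfl fun σ _ => iSup_congr fun w => ?_
  rw [Fin.sum_univ_castSucc]
  simp only [Fin.snoc_castSucc, Fin.snoc_last]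
  have h1 (s : Fin t) : Fin.castLE ht s.castSucc = Fin.castLE ht.le s := rfl
  have h2 : Fin.castLE ht (Fin.last t) = ⟨t, ht⟩ := rfl
  simp only [h1, h2]
  ring

/-- Resampling the signs of one row does not change the average. -/
lemma sum_sum_row_resample {α β : Type*} [Fintype α] [Fintype β] [DecidableEq α] [DecidableEq β]
    (a : α) (S : (α × β → Bool) → ℝ) :
    ∑ σ : α × β → Bool, ((2 : ℝ) ^ Fintype.card β)⁻¹ *
        ∑ τ : β → Bool, S (fun p => if p.1 = a then τ p.2 else σ p)
      = ∑ σ, S σ := by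
  have h (σ : α × β → Bool) :
      ∑ τ : β → Bool, S (fun p => if p.1 = a then τ p.2 else σ p)
        = ∑ τ : β → Bool, S (fun p => xor (decide (p.1 = a) && τ p.2) (σ p)) := by
    rw [← sum_comp_xor (fun k => σ (a, k))]
    refine Finset.sum_congr rfl fun τ _ => congrArg S ?_
    funext ⟨i, k⟩
    by_cases hi : i = a
    · subst hi
      simp [Bool.xor_comm]
    · simp [hi]
  simp only [h]
  rw [← Finset.mul_sum, Finset.sum_comm]
  simp only [sum_comp_xor, Finset.sum_const, Finset.card_univ, Fintype.card_fun,
    Fintype.card_bool, nsmul_eq_mul, Nat.cast_pow, Nat.cast_ofNat]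
  rw [inv_mul_cancel_left₀ (by positivity)]

/-- the penalized relaxation built from a nonempty set `W` (e.g.
the feasible vectors of a level-`r` Lasserre SDP), projected matrices
`M : W → [0,1]^{V×κ}` with rows summing to 1, costs `c : W → [0,∞)`, penalty
`λ ≥ 0` and budget `K ≥ 0`, satisfies (a) the dominance condition for every
nonempty finite class `G` each of whose members lifts to some `w ∈ W` with the
same assignment matrix and cost at most `K`, and (b) the recursive
admissibility condition, witnessed by any minimizing `q̂(ε)`.  Hence it is an
admissible relaxation for `G`. -/
theorem stmt_8 (V κ : ℕ) (hV : 0 < V) (hκ : 0 < κ)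
    (W : Type) [Nonempty W]
    (M : W → Fin V → Fin κ → ℝ) (c : W → ℝ)
    (hM01 : ∀ w t k, M w t k ∈ Set.Icc (0 : ℝ) 1)
    (hMrow : ∀ w t, ∑ k, M w t k = 1)
    (hc0 : ∀ w, 0 ≤ c w)
    (lam K : ℝ) (hlam : 0 ≤ lam) (hK : 0 ≤ K)
    (G : Finset (Fin V → Fin κ)) (hG : G.Nonempty)
    (hGW : ∀ f ∈ G, ∃ w : W,
      M w = (fun t k => if f t = k then (1 : ℝ) else 0) ∧ c w ≤ K) :
    -- (a) dominance
    (∀ y : Fin V → Fin κ,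
      relaxPen V κ W M c lam K V le_rfl y
        ≥ - G.inf' hG (fun f => ∑ t, if f t ≠ y t then (1 : ℝ) else 0))
    ∧
    -- (b) recursive admissibility of the minimizing randomized strategy
    (∀ (t : ℕ) (ht : t < V) (ys : Fin t → Fin κ)
      (qhat : (Fin V × Fin κ → Bool) → Fin κ → ℝ),
      (∀ σ k, 0 ≤ qhat σ k) → (∀ σ, ∑ k, qhat σ k = 1) →
      (∀ (σ : Fin V × Fin κ → Bool) (q : Fin κ → ℝ),
        (∀ k, 0 ≤ q k) → (∑ k, q k = 1) →
        Finset.univ.sup' ⟨⟨0, hκ⟩, Finset.mem_univ _⟩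
            (fun y => 1 - qhat σ y + RobjPen V κ W M c lam t ht ys σ y)
          ≤ Finset.univ.sup' ⟨⟨0, hκ⟩, Finset.mem_univ _⟩
            (fun y => 1 - q y + RobjPen V κ W M c lam t ht ys σ y)) →
      Finset.univ.sup' ⟨⟨0, hκ⟩, Finset.mem_univ _⟩ (fun y : Fin κ =>
          ((2 : ℝ) ^ (V * κ))⁻¹ * (∑ σ : Fin V × Fin κ → Bool, (1 - qhat σ y))
            + relaxPen V κ W M c lam K (t + 1) ht (Fin.snoc ys y))
        ≤ relaxPen V κ W M c lam K t ht.le ys) := by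
  refine ⟨fun y => ?_, fun t ht ys qhat _ _ hmin => ?_⟩
  · obtain ⟨f, hf, hfe⟩ := G.exists_mem_eq_inf' hG
      (fun f => ∑ t, if f t ≠ y t then (1 : ℝ) else 0)
    rw [hfe, ge_iff_le]
    obtain ⟨w, hw, hcw⟩ := hGW f hf
    have hval (σ : Fin V × Fin κ → Bool) :=
      le_ciSup (bddAbove_penalized_process hM01 hc0 hlam V V le_rfl y σ) w
    have hzero (j : Fin V) : ¬ V ≤ (j : ℕ) := not_le.mpr j.2
    simp only [hzero, if_false, Finset.sum_const_zero, mul_zero, zero_add, hw,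
      Fin.castLE_rfl, id] at hval
    have havg := mul_le_mul_of_nonneg_left
      (Finset.sum_le_sum fun σ (_ : σ ∈ Finset.univ) => hval σ)
      (show (0 : ℝ) ≤ ((2 : ℝ) ^ (V * κ))⁻¹ by positivity)
    rw [inv_two_pow_mul_sum_const] at havg
    have hcount : ∑ t, (if f t = y t then (1 : ℝ) else 0)
        + ∑ t, (if f t ≠ y t then (1 : ℝ) else 0) = V := by
      rw [← Finset.sum_add_distrib]
      have h1 (t : Fin V) : (if f t = y t then (1 : ℝ) else 0)
          + (if f t ≠ y t then (1 : ℝ) else 0) = 1 := by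
        by_cases h : f t = y t <;> simp [h]
      rw [Finset.sum_congr rfl fun t _ => h1 t]
      simp
    have hpen := mul_le_mul_of_nonneg_left hcw hlam
    unfold relaxPen
    simp only [hzero, if_false, Finset.sum_const_zero, mul_zero, zero_add, Fin.castLE_rfl, id]
    linarith
  · have : Nonempty (Fin κ) := ⟨⟨0, hκ⟩⟩
    refine Finset.sup'_le _ _ fun y _ => ?_
    rw [relaxPen_snoc]
    set S : (Fin V × Fin κ → Bool) → ℝ := fun σ =>
      ⨆ w : W, (2 * ∑ j : Fin V, ∑ k : Fin κ,
          (if t ≤ (j : ℕ) then sg (σ (j, k)) * M w j k else 0)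
        + ∑ s : Fin t, M w (Fin.castLE ht.le s) (ys s) - lam * c w) with hS
    have key (σ : Fin V × Fin κ → Bool) :
        1 - qhat σ y + RobjPen V κ W M c lam t ht ys σ y
          ≤ 1 + ((2 : ℝ) ^ Fintype.card (Fin κ))⁻¹ * ∑ τ : Fin κ → Bool,
            S (fun p => if p.1 = ⟨t, ht⟩ then τ p.2 else σ p) := by
      obtain ⟨q, hq0, hq1, hq⟩ := exists_prob_iSup_sub_le _ (fun w => M w ⟨t, ht⟩)
        (bddAbove_penalized_process hM01 hc0 hlam (t + 1) t ht.le ys σ)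
        (fun w k => (hM01 w _ k).1) (fun w => hMrow w _)
      have hrow (τ : Fin κ → Bool) :
          S (fun p => if p.1 = ⟨t, ht⟩ then τ p.2 else σ p)
            = ⨆ w, (2 * ∑ j : Fin V, ∑ k : Fin κ,
                (if t + 1 ≤ (j : ℕ) then sg (σ (j, k)) * M w j k else 0)
              + ∑ s : Fin t, M w (Fin.castLE ht.le s) (ys s) - lam * c w
              + 2 * ∑ k, sg (τ k) * M w ⟨t, ht⟩ k) := by
        refine iSup_congr fun w => ?_
        rw [sum_future_rows_eq ht
          (fun j k => sg (if j = ⟨t, ht⟩ then τ k else σ (j, k)) * M w j k)]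
        have hfut (j : Fin V) (k : Fin κ) :
            (if t + 1 ≤ (j : ℕ) then
              sg (if j = ⟨t, ht⟩ then τ k else σ (j, k)) * M w j k else 0)
            = if t + 1 ≤ (j : ℕ) then sg (σ (j, k)) * M w j k else 0 := by
          split_ifs with h1 h2
          · simp [h2] at h1
          · rfl
          · rfl
        simp only [hfut, if_true]
        ring
      have hR (o : Fin κ) : RobjPen V κ W M c lam t ht ys σ o
          = ⨆ w, (2 * ∑ j : Fin V, ∑ k : Fin κ,
                (if t + 1 ≤ (j : ℕ) then sg (σ (j, k)) * M w j k else 0)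
              + ∑ s : Fin t, M w (Fin.castLE ht.le s) (ys s) - lam * c w
              + M w ⟨t, ht⟩ o) :=
        iSup_congr fun w => by ring
      simp only [hrow]
      refine (Finset.le_sup' (fun y => 1 - qhat σ y + RobjPen V κ W M c lam t ht ys σ y)
        (Finset.mem_univ y)).trans ((hmin σ q hq0 hq1).trans ?_)
      refine Finset.sup'_le _ _ fun o _ => ?_
      have := hq o
      rw [hR]
      linarith
    have hsum := Finset.sum_le_sum fun σ (_ : σ ∈ Finset.univ) => key σ
    rw [Finset.sum_add_distrib, Finset.sum_add_distrib, sum_sum_row_resample] at hsum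
    have havg := mul_le_mul_of_nonneg_left hsum
      (show (0 : ℝ) ≤ ((2 : ℝ) ^ (V * κ))⁻¹ by positivity)
    rw [mul_add, mul_add, inv_two_pow_mul_sum_const] at havg
    unfold relaxPen
    linarith

end Stmt8
end

section
/- Let I be a nonempty finite set, μ a probability distribution on I^V, and for each ι ∈ I^V let F(ι) be a nonempty finite set of label sequences with values in [2] = {1,2}. Let the forecaster be any family of maps σ_t : I^t × [2]^{t−1} → (probability vectors on [2]), t = 1,…,V. Draw ι ∼ μ and, independently of ι and of everything else, labels y_1,…,y_V i.i.d. uniform on {1,2}. Then the expected regret satisfies E_{ι∼μ} E_{y∼Unif({1,2}^V)} [ Σ_{t=1}^V (1 − σ_t(ι_{1:t}, y_{1:t−1})(y_t)) − min_{f∈F(ι)} Σ_{t=1}^V 1{f(t)≠y_t} ] ≥ (1/2) · E_{ι∼μ} Rad₂(F(ι)). -/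
namespace Stmt11

/-- The two-column Rademacher complexity `Rad₂(F)` of a nonempty finite class
`F` of binary label sequences. -/
noncomputable def rad2 (V : ℕ) (F : Finset (Fin V → Fin 2)) (hF : F.Nonempty) : ℝ :=
  ((2 : ℝ) ^ (V * 2))⁻¹ * ∑ σ : Fin V × Fin 2 → Bool,
    F.sup' hF (fun f => ∑ t : Fin V, ∑ k : Fin 2,
      (if σ (t, k) then (1 : ℝ) else -1) * (if f t = k then (1 : ℝ) else 0))

/-- The average of a quantity depending on a uniformly random label `y t` and on the other labels
only is half its sum over the two values of that label. -/
theorem sum_apply_coord {V : ℕ} (t : Fin V) (g : (Fin V → Fin 2) → Fin 2 → ℝ) (c : ℝ)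
    (hg : ∀ y a k, g (Function.update y t a) k = g y k) (hc : ∀ y, ∑ k, g y k = c) :
    ∑ y : Fin V → Fin 2, g y (y t) = 2 ^ V * (c / 2) := by
  have hinv : Function.Involutive
      (fun y : Fin V → Fin 2 => Function.update y t (1 - y t)) := by
    intro y
    simp
  have hflip : ∑ y : Fin V → Fin 2, g y (1 - y t) = ∑ y : Fin V → Fin 2, g y (y t) := by
    rw [← Equiv.sum_comp hinv.toPerm (fun y => g y (y t))]
    refine Finset.sum_congr rfl fun y _ => ?_
    simp [Function.Involutive.toPerm, hg]
  have hadd : ∑ y : Fin V → Fin 2, (g y (y t) + g y (1 - y t)) = 2 ^ V * c := by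
    rw [Finset.sum_congr rfl (g := fun _ => c)]
    · simp
    · intro y _
      rw [← hc y, Fin.sum_univ_two]
      generalize y t = a
      fin_cases a
      · simp
      · simp [add_comm]
  rw [Finset.sum_add_distrib, hflip] at hadd
  linarith

/-- A pair of label sequences encodes a sign table: the first gives the signs of column `0`, the
second those of column `1`. -/
def signEquiv (V : ℕ) : ((Fin V → Fin 2) × (Fin V → Fin 2)) ≃ (Fin V × Fin 2 → Bool) where
  toFun p i := decide ((if i.2 = 0 then p.1 i.1 else p.2 i.1) = i.2)
  invFun σ := (fun t => if σ (t, 0) then 0 else 1, fun t => if σ (t, 1) then 1 else 0)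
  left_inv p := by
    ext t
    · generalize h : p.1 t = a
      fin_cases a <;> simp [h]
    · generalize h : p.2 t = a
      fin_cases a <;> simp [h]
  right_inv σ := by
    ext ⟨t, k⟩
    fin_cases k <;> simp

theorem sum_sign_coord {V : ℕ} (t : Fin V) (k : Fin 2) :
    ∑ y : Fin V → Fin 2, (if y t = k then (1 : ℝ) else -1) = 0 := by
  have h := sum_apply_coord t (fun _ a => if a = k then (1 : ℝ) else -1) 0 (fun _ _ _ => rfl)
    (fun _ => by fin_cases k <;> simp)
  simpa using h

/-- The Rademacher complexity in terms of the minimal number of mistakes on random labels. -/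
theorem rad2_le (V : ℕ) (F : Finset (Fin V → Fin 2)) (hF : F.Nonempty) :
    rad2 V F hF ≤ V - 2 * (((2 : ℝ) ^ V)⁻¹ * ∑ y : Fin V → Fin 2,
      F.inf' hF (fun f => ∑ t, if f t ≠ y t then (1 : ℝ) else 0)) := by
  set L : (Fin V → Fin 2) → ℝ :=
    fun y => F.inf' hF (fun f => ∑ t, if f t ≠ y t then (1 : ℝ) else 0)
  have hL (y f : Fin V → Fin 2) (hf : f ∈ F) :
      L y ≤ ∑ t, if f t ≠ y t then (1 : ℝ) else 0 := by
    simp only [L]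
    exact Finset.inf'_le _ hf
  change _ ≤ V - 2 * (((2 : ℝ) ^ V)⁻¹ * ∑ y, L y)
  set B : Fin 2 → (Fin V → Fin 2) → ℝ :=
    fun k y => (∑ t, if y t = k then (1 : ℝ) else -1) / 2
  have hB (k : Fin 2) : ∑ y, B k y = 0 := by
    simp only [B]
    rw [← Finset.sum_div, Finset.sum_comm]
    simp [sum_sign_coord]
  have hpair : ∀ p : (Fin V → Fin 2) × (Fin V → Fin 2),
      F.sup' hF (fun f => ∑ t : Fin V, ∑ k : Fin 2,
        (if signEquiv V p (t, k) then (1 : ℝ) else -1) * (if f t = k then (1 : ℝ) else 0))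
      ≤ (B 0 p.1 - L p.1) + (B 1 p.2 - L p.2) + V := by
    rintro ⟨y, z⟩
    refine Finset.sup'_le _ _ fun f hf => ?_
    have hy := hL y f hf
    have hz := hL z f hf
    have hV : (V : ℝ) = ∑ _t : Fin V, (1 : ℝ) := by simp
    have hsum : ∑ t : Fin V, ∑ k : Fin 2,
        (if signEquiv V (y, z) (t, k) then (1 : ℝ) else -1) * (if f t = k then (1 : ℝ) else 0)
        = (B 0 y - ∑ t, if f t ≠ y t then (1 : ℝ) else 0)
          + (B 1 z - ∑ t, if f t ≠ z t then (1 : ℝ) else 0) + V := by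
      simp only [B]
      rw [hV, Finset.sum_div, Finset.sum_div, ← Finset.sum_sub_distrib, ← Finset.sum_sub_distrib,
        ← Finset.sum_add_distrib, ← Finset.sum_add_distrib]
      refine Finset.sum_congr rfl fun t _ => ?_
      simp only [signEquiv, Equiv.coe_fn_mk, Fin.sum_univ_two, decide_eq_true_eq, if_true,
        one_ne_zero, if_false]
      generalize f t = a
      generalize y t = b
      generalize z t = c
      fin_cases a <;> fin_cases b <;> fin_cases c <;> norm_num
    linarith
  have hcard : (Fintype.card (Fin V → Fin 2) : ℝ) = 2 ^ V := by simp
  have htotal : ∑ p : (Fin V → Fin 2) × (Fin V → Fin 2),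
      ((B 0 p.1 - L p.1) + (B 1 p.2 - L p.2) + V)
      = 2 ^ (V * 2) * (V - 2 * (((2 : ℝ) ^ V)⁻¹ * ∑ y, L y)) := by
    simp only [Fintype.sum_prod_type, Finset.sum_add_distrib, Finset.sum_sub_distrib,
      Finset.sum_const, Finset.card_univ, Fintype.card_prod, Nat.cast_mul, nsmul_eq_mul, ← Finset.mul_sum,
      hB, hcard]
    field_simp
    ring
  rw [rad2, ← Equiv.sum_comp (signEquiv V), inv_mul_le_iff₀ (by positivity), ← htotal]
  exact Finset.sum_le_sum fun p _ => hpair p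

/-- Any forecaster errs half of the time on uniformly random binary labels. -/
theorem sum_forecast_loss (V : ℕ) (q : (t : Fin V) → (Fin (t : ℕ) → Fin 2) → Fin 2 → ℝ)
    (hq : ∀ t ys, ∑ k, q t ys k = 1) :
    ∑ y : Fin V → Fin 2, ∑ t : Fin V,
      (1 - q t (fun s : Fin (t : ℕ) => y (Fin.castLE t.isLt.le s)) (y t)) = 2 ^ V * (V / 2) := by
  have hround (t : Fin V) : ∑ y : Fin V → Fin 2,
      (1 - q t (fun s : Fin (t : ℕ) => y (Fin.castLE t.isLt.le s)) (y t))
        = 2 ^ V * (1 / 2) := by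
    refine sum_apply_coord t
      (fun y k => 1 - q t (fun s : Fin (t : ℕ) => y (Fin.castLE t.isLt.le s)) k) 1 ?_ ?_
    · intro y a k
      have hpast : (fun s : Fin (t : ℕ) => Function.update y t a (Fin.castLE t.isLt.le s))
          = fun s => y (Fin.castLE t.isLt.le s) := by
        funext s
        refine Function.update_of_ne (fun h => ?_) _ _
        have hval := congrArg Fin.val h
        have hlt := s.isLt
        simp only [Fin.val_castLE] at hval
        omega
      simp only [hpast]
    · intro y
      rw [Finset.sum_sub_distrib, hq]
      norm_num
  rw [Finset.sum_comm, Finset.sum_congr rfl fun t _ => hround t]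
  simp only [Finset.sum_const, Finset.card_univ, Fintype.card_fin, nsmul_eq_mul]
  ring

/-- the paper's lower bound, Proposition 1: for any instance
generating process `μ`, any benchmark classes `F(ι)` and any forecaster `σf`,
uniformly random binary labels force expected regret at least
`(1/2) E_{ι∼μ} Rad₂(F(ι))`.  Rounds are 0-indexed: at round `t : Fin V` the
forecaster has seen the instance prefix of length `t + 1` and the labels of the
first `t` rounds. -/
theorem stmt_11 (V : ℕ) (hV : 0 < V)
    (I : Type) [Fintype I] [Nonempty I]
    (μ : (Fin V → I) → ℝ) (hμ0 : ∀ ι, 0 ≤ μ ι) (hμ1 : ∑ ι, μ ι = 1)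
    (F : (Fin V → I) → Finset (Fin V → Fin 2)) (hF : ∀ ι, (F ι).Nonempty)
    (σf : (t : Fin V) → (Fin ((t : ℕ) + 1) → I) → (Fin (t : ℕ) → Fin 2) → Fin 2 → ℝ)
    (hσf0 : ∀ t p ys k, 0 ≤ σf t p ys k)
    (hσf1 : ∀ t p ys, ∑ k, σf t p ys k = 1) :
    ∑ ι, μ ι * (((2 : ℝ) ^ V)⁻¹ * ∑ y : Fin V → Fin 2,
        ((∑ t : Fin V, (1 - σf t (fun i => ι (Fin.castLE t.isLt i))
            (fun s : Fin (t : ℕ) => y (Fin.castLE t.isLt.le s)) (y t)))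
          - (F ι).inf' (hF ι) (fun f => ∑ t, if f t ≠ y t then (1 : ℝ) else 0)))
      ≥ (1 / 2 : ℝ) * ∑ ι, μ ι * rad2 V (F ι) (hF ι) := by
  rw [ge_iff_le, Finset.mul_sum]
  refine Finset.sum_le_sum fun ι _ => ?_
  rw [mul_left_comm]
  refine mul_le_mul_of_nonneg_left ?_ (hμ0 ι)
  rw [Finset.sum_sub_distrib, sum_forecast_loss V
    (fun t ys => σf t (fun i => ι (Fin.castLE t.isLt i)) ys) (fun t ys => hσf1 t _ ys), mul_sub,
    inv_mul_cancel_left₀ (by positivity)]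
  linarith [rad2_le V (F ι) (hF ι)]

end Stmt11
end

section
/- Let V be a positive integer and F a nonempty finite set of label sequences with values in [2] = {1,2}. Then E_{y∼Unif({1,2}^V)} [ max_{f∈F} Σ_{t=1}^V ( 1{f(t)=y_t} − 1/2 ) ] ≥ (1/2) · Rad₂(F), i.e. 2^{−V} Σ_{y∈{1,2}^V} max_{f∈F} Σ_{t=1}^V ( 1{f(t)=y_t} − 1/2 ) ≥ (1/2) · 2^{−2V} Σ_{ε∈{−1,1}^{V×2}} max_{f∈F} Σ_{t=1}^V Σ_{k=1}^2 ε_{t,k} 1{f(t)=k}. -/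
/-- Sign matrices `σ` with two columns correspond to pairs of binary label sequences: the first
sequence has label `0` where column `0` is positive, the second has label `1` where column `1`
is positive. -/
def signsEquivLabelPairs (ι : Type*) :
    (ι × Fin 2 → Bool) ≃ (ι → Fin 2) × (ι → Fin 2) where
  toFun σ := (fun t => if σ (t, 0) then 0 else 1, fun t => if σ (t, 1) then 1 else 0)
  invFun p := fun x => if x.2 = 0 then decide (p.1 x.1 = 0) else decide (p.2 x.1 = 1)
  left_inv σ := by
    funext ⟨t, k⟩
    fin_cases k <;> simp
  right_inv p := by
    ext t
    · have : p.1 t = 0 ∨ p.1 t = 1 := by lia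
      rcases this with h | h <;> simp [h]
    · have : p.2 t = 0 ∨ p.2 t = 1 := by lia
      rcases this with h | h <;> simp [h]

theorem sum_signsEquivLabelPairs_add {ι : Type*} [Fintype ι] [DecidableEq ι]
    (h : (ι → Fin 2) → ℝ) :
    ∑ σ : ι × Fin 2 → Bool, (h (signsEquivLabelPairs ι σ).1 + h (signsEquivLabelPairs ι σ).2)
      = 2 * (2 : ℝ) ^ Fintype.card ι * ∑ y, h y := by
  rw [(signsEquivLabelPairs ι).sum_comp (fun p => h p.1 + h p.2), Fintype.sum_prod_type]
  simp only [Finset.sum_add_distrib, Finset.sum_const, Finset.card_univ, Fintype.card_pi,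
    Fintype.card_fin, Finset.prod_const, nsmul_eq_mul, ← Finset.mul_sum]
  push_cast
  ring

theorem sum_bool_sign_eq_zero {ι : Type*} [Fintype ι] [DecidableEq ι] (i : ι) :
    ∑ σ : ι → Bool, (if σ i then (1 : ℝ) else -1) = 0 := by
  have h := (Equiv.arrowCongr (Equiv.refl ι) Equiv.boolNot).sum_comp
    (fun σ : ι → Bool => if σ i then (1 : ℝ) else -1)
  have h' : ∀ σ : ι → Bool,
      (if (Equiv.arrowCongr (Equiv.refl ι) Equiv.boolNot) σ i then (1 : ℝ) else -1)
        = -(if σ i then (1 : ℝ) else -1) := by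
    intro σ
    cases hσ : σ i <;> simp [hσ]
  simp only [h', Finset.sum_neg_distrib] at h
  linarith

theorem sum_sign_mul_indicator_eq {ι : Type*} (σ : ι × Fin 2 → Bool) (f : ι → Fin 2) (t : ι) :
    ∑ k, (if σ (t, k) then (1 : ℝ) else -1) * (if f t = k then (1 : ℝ) else 0)
      = (∑ k, (if σ (t, k) then (1 : ℝ) else -1)) / 2
        + (((if f t = (signsEquivLabelPairs ι σ).1 t then (1 : ℝ) else 0) - 1 / 2)
          + ((if f t = (signsEquivLabelPairs ι σ).2 t then (1 : ℝ) else 0) - 1 / 2)) := by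
  have : f t = 0 ∨ f t = 1 := by lia
  rcases this with h | h <;> cases h0 : σ (t, 0) <;> cases h1 : σ (t, 1) <;>
    norm_num [signsEquivLabelPairs, h, h0, h1]

/-- desymmetrization for binary labels.  The expected (over
uniform random binary labels `y`) maximal correlation of the class `F` with the
centered indicators `1{f(t)=y_t} − 1/2` is at least half the two-column
Rademacher complexity of `F`. -/
theorem stmt_13 (V : ℕ) (hV : 0 < V)
    (F : Finset (Fin V → Fin 2)) (hF : F.Nonempty) :
    ((2 : ℝ) ^ V)⁻¹ * ∑ y : Fin V → Fin 2,
        F.sup' hF (fun f => ∑ t, ((if f t = y t then (1 : ℝ) else 0) - 1 / 2))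
      ≥ (1 / 2 : ℝ) * (((2 : ℝ) ^ (V * 2))⁻¹ * ∑ σ : Fin V × Fin 2 → Bool,
          F.sup' hF (fun f => ∑ t, ∑ k,
            (if σ (t, k) then (1 : ℝ) else -1) * (if f t = k then (1 : ℝ) else 0))) := by
  set h : (Fin V → Fin 2) → ℝ := fun y =>
    F.sup' hF (fun f => ∑ t, ((if f t = y t then (1 : ℝ) else 0) - 1 / 2))
  have pointwise : ∀ σ : Fin V × Fin 2 → Bool,
      F.sup' hF (fun f => ∑ t, ∑ k,
          (if σ (t, k) then (1 : ℝ) else -1) * (if f t = k then (1 : ℝ) else 0))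
        ≤ (∑ t, (∑ k, (if σ (t, k) then (1 : ℝ) else -1)) / 2)
          + (h (signsEquivLabelPairs _ σ).1 + h (signsEquivLabelPairs _ σ).2) := by
    intro σ
    refine Finset.sup'_le hF _ fun f hf => ?_
    simp only [sum_sign_mul_indicator_eq, Finset.sum_add_distrib]
    have le_h : ∀ y : Fin V → Fin 2,
        ∑ t, ((if f t = y t then (1 : ℝ) else 0) - 1 / 2) ≤ h y := fun y =>
      Finset.le_sup' (fun g : Fin V → Fin 2 =>
        ∑ t, ((if g t = y t then (1 : ℝ) else 0) - 1 / 2)) hf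
    gcongr <;> exact le_h _
  have centered : ∑ σ : Fin V × Fin 2 → Bool,
      ∑ t, (∑ k, (if σ (t, k) then (1 : ℝ) else -1)) / 2 = 0 := by
    rw [Finset.sum_comm]
    refine Finset.sum_eq_zero fun t _ => ?_
    rw [← Finset.sum_div, Finset.sum_comm]
    simp only [sum_bool_sign_eq_zero, Finset.sum_const_zero, zero_div]
  have total := Finset.sum_le_sum fun σ (_ : σ ∈ Finset.univ) => pointwise σ
  rw [Finset.sum_add_distrib, centered, sum_signsEquivLabelPairs_add, zero_add,
    Fintype.card_fin] at total
  calc (1 / 2 : ℝ) * (((2 : ℝ) ^ (V * 2))⁻¹ * _)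
      ≤ (1 / 2 : ℝ) * (((2 : ℝ) ^ (V * 2))⁻¹ * (2 * (2 : ℝ) ^ V * ∑ y, h y)) := by gcongr
    _ = ((2 : ℝ) ^ V)⁻¹ * ∑ y, h y := by
      rw [pow_mul]
      field_simp
end
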